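/- arXiv:2005.13878 — 5 statements merged into one kernel-verified Lean document; each statement's English description precedes it below -/
import Mathlib

section
/- For every real s > 0, ∫_0^∞ cos(sx) · x·e^{-πx/4} / ((1 + x²)·cosh(πx/4)) dx = (π/2)·e^{-s} + 2·sinh(s)·arctan(e^{-s}) - cosh(s)·log(1 + e^{-s}) - (e^{-s}/2)·( Ei(s) - log(1 - e^{-s}) ) - (e^{s}/2)·( Ei(-s) - log(1 - e^{-s}) ). -/
/-- The exponential integral `Ei`: for `x < 0`, `Ei(x) = -∫_{-x}^∞ e^{-t}/t dt`, and for
`x > 0`, `Ei(x) = γ + log x + Σ_{k=1}^∞ x^k/(k·k!)` (Cauchy principal value). -/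
noncomputable def Ei (x : ℝ) : ℝ :=
  if x < 0 then -∫ t in Set.Ioi (-x), Real.exp (-t) / t
  else Real.eulerMascheroniConstant + Real.log x +
    ∑' k : ℕ, x ^ (k + 1) / (((k + 1) * (k + 1).factorial : ℕ) : ℝ)

open Filter Set Real MeasureTheory Topology Asymptotics

theorem integrable_log_mul_exp_neg_and_integral :
    IntegrableOn (fun t : ℝ => log t * exp (-t)) (Ioi 0) ∧
      ∫ t in Ioi (0 : ℝ), log t * exp (-t) = -eulerMascheroniConstant := by
  have key := mellin_hasDerivAt_of_isBigO_rpow (E := ℂ) (a := 2) (b := 0)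
    (f := fun x : ℝ => ((exp (-x) : ℝ) : ℂ)) (s := 1) ?_ ?_ (by norm_num) ?_ (by norm_num)
  · have e : (fun t : ℝ => (t : ℂ) ^ ((1 : ℂ) - 1) • (log t • ((exp (-t) : ℝ) : ℂ))) =
        fun t : ℝ => ((log t * exp (-t) : ℝ) : ℂ) := by
      ext t; simp
    refine ⟨?_, ?_⟩
    · have h1 := key.1
      rw [MellinConvergent, e] at h1
      exact h1.re
    · have h2 := key.2
      rw [← Complex.GammaIntegral_eq_mellin, mellin, e] at h2
      have h3 : HasDerivAt Complex.GammaIntegral (-eulerMascheroniConstant : ℂ) 1 := by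
        refine Complex.hasDerivAt_Gamma_one.congr_of_eventuallyEq ?_
        have : ∀ᶠ s : ℂ in 𝓝 1, 0 < s.re :=
          Complex.continuous_re.continuousAt.eventually (lt_mem_nhds (by norm_num))
        filter_upwards [this] with s hs
        rw [Complex.Gamma_eq_integral hs]
      have h4 := h2.unique h3
      rw [integral_complex_ofReal] at h4
      exact_mod_cast h4
  · refine (Continuous.continuousOn ?_).locallyIntegrableOn measurableSet_Ioi
    fun_prop
  · rw [← isBigO_norm_left]
    simp_rw [Complex.norm_real, isBigO_norm_left]
    simpa only [neg_one_mul] using (isLittleO_exp_neg_mul_rpow_atTop zero_lt_one _).isBigO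
  · simp_rw [neg_zero, rpow_zero]
    refine isBigO_const_of_tendsto (?_ : Tendsto _ _ (𝓝 (1 : ℂ))) one_ne_zero
    rw [(by simp : (1 : ℂ) = (exp (-0) : ℝ))]
    exact (Complex.continuous_ofReal.comp (by fun_prop)).continuousWithinAt

theorem integrableOn_exp_neg_div {s : ℝ} (hs : 0 < s) :
    IntegrableOn (fun t : ℝ => exp (-t) / t) (Ioi s) := by
  refine Integrable.mono' ((integrableOn_exp_neg_Ioi s).mul_const s⁻¹) ?_ ?_
  · exact (by fun_prop : Measurable fun t : ℝ => exp (-t) / t).aestronglyMeasurable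
  · filter_upwards [ae_restrict_mem measurableSet_Ioi] with t ht
    have ht : s < t := ht
    have : 0 < t := hs.trans ht
    rw [norm_of_nonneg (by positivity), div_eq_mul_inv]
    gcongr

theorem tendsto_expIntegral_add_log :
    Tendsto (fun s : ℝ => (∫ t in Ioi s, exp (-t) / t) + log s) (𝓝[>] 0)
      (𝓝 (-eulerMascheroniConstant)) := by
  obtain ⟨hint, hval⟩ := integrable_log_mul_exp_neg_and_integral
  have hparts : ∀ s : ℝ, 0 < s → (∫ t in Ioi s, exp (-t) / t) =
      (∫ t in Ioi s, log t * exp (-t)) - exp (-s) * log s := by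
    intro s hs
    have h1 := integral_Ioi_of_hasDerivAt_of_tendsto' (a := s)
      (f := fun t : ℝ => exp (-t) * log t) (f' := fun t => exp (-t) / t - log t * exp (-t))
      (m := 0) ?_ ((integrableOn_exp_neg_div hs).sub (hint.mono_set (Ioi_subset_Ioi hs.le))) ?_
    · rw [integral_sub (integrableOn_exp_neg_div hs) (hint.mono_set (Ioi_subset_Ioi hs.le))] at h1
      linarith
    · intro t ht
      have : t ≠ 0 := (hs.trans_le ht).ne'
      refine (((hasDerivAt_neg t).exp).mul (hasDerivAt_log this)).congr_deriv ?_
      ring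
    · have hexp : (id : ℝ → ℝ) =O[atTop] exp :=
        (isLittleO_pow_exp_atTop (n := 1)).isBigO.congr_left fun x => by simp
      have h := (isLittleO_log_id_atTop.trans_isBigO hexp).tendsto_div_nhds_zero
      refine h.congr fun x => ?_
      rw [exp_neg]; field_simp
  have hlim : Tendsto (fun s : ℝ => ∫ t in Ioi s, log t * exp (-t)) (𝓝[>] 0)
      (𝓝 (-eulerMascheroniConstant)) := by
    rw [← hval]
    have := (hint.continuousOn_Ici_primitive_Ioi) 0 self_mem_Ici
    exact this.tendsto.mono_left (nhdsWithin_mono _ Ioi_subset_Ici_self)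
  have hsmall : Tendsto (fun s : ℝ => (1 - exp (-s)) * log s) (𝓝[>] 0) (𝓝 0) := by
    have h0 : Tendsto (fun s : ℝ => log s * s) (𝓝[>] 0) (𝓝 0) := by
      simpa using tendsto_log_mul_rpow_nhdsGT_zero one_pos
    refine squeeze_zero_norm' (a := fun s : ℝ => ‖log s * s‖) ?_ (by simpa using h0.norm)
    filter_upwards [self_mem_nhdsWithin] with s hs
    have hs : (0 : ℝ) < s := hs
    rw [norm_mul, norm_mul, mul_comm]
    gcongr
    rw [norm_of_nonneg hs.le, norm_of_nonneg (by simp [hs.le])]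
    linarith [add_one_le_exp (-s)]
  have := hlim.add hsmall
  rw [add_zero] at this
  refine this.congr' ?_
  filter_upwards [self_mem_nhdsWithin] with s hs
  rw [hparts s hs]; ring

theorem hasSum_div_sq_add_sq {z : ℝ} (hz : 0 < z) :
    HasSum (fun n : ℕ => z / (z ^ 2 + (n + 1) ^ 2))
      ((π * (cosh (π * z) / sinh (π * z)) - 1 / z) / 2) := by
  set x : ℂ := z * Complex.I with hx
  have hxint : x ∈ Complex.integerComplement := by
    rintro ⟨n, hn⟩
    have := congrArg Complex.im hn
    simp [hx] at this
    exact hz.ne this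
  have hsum := (summable_cotTerm hxint).hasSum
  have hcot := cot_series_rep' hxint
  have hterm : ∀ n : ℕ, 1 / (x - (n + 1)) + 1 / (x + (n + 1)) =
      (-2 * Complex.I) * ((z / (z ^ 2 + (n + 1) ^ 2) : ℝ) : ℂ) := by
    intro n
    have h1 : x - (n + 1) ≠ 0 := fun h => by
      have := congrArg Complex.im h
      simp [hx] at this
      exact hz.ne' this
    have h2 : x + (n + 1) ≠ 0 := fun h => by
      have := congrArg Complex.im h
      simp [hx] at this
      exact hz.ne' this
    have h3 : ((z : ℂ) ^ 2 + (n + 1) ^ 2) ≠ 0 := by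
      have : (z ^ 2 + (n + 1) ^ 2 : ℝ) ≠ 0 := by positivity
      exact_mod_cast this
    push_cast
    rw [div_add_div _ _ h1 h2, mul_div_assoc', div_eq_div_iff (mul_ne_zero h1 h2) h3, hx]
    linear_combination (2 * Complex.I * z^3) * Complex.I_sq
  have hval : π * Complex.cot (π * x) - 1 / x =
      (-2 * Complex.I) *
        (((π * (cosh (π * z) / sinh (π * z)) - 1 / z) / 2 : ℝ) : ℂ) := by
    have hs : Complex.sinh (π * z) ≠ 0 := by
      have : sinh (π * z) ≠ 0 := (sinh_pos_iff.2 (by positivity)).ne'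
      exact_mod_cast this
    have hz' : (z : ℂ) ≠ 0 := by exact_mod_cast hz.ne'
    rw [Complex.cot, hx, ← mul_assoc, Complex.cos_mul_I, Complex.sin_mul_I]
    push_cast
    field_simp
    linear_combination (π * Complex.cosh (π * z) * z - Complex.sinh (π * z)) * Complex.I_sq
  have h2I : (-2 * Complex.I) ≠ 0 := by simp
  rw [← hcot, hval] at hsum
  simp only [cotTerm, hterm] at hsum
  exact Complex.hasSum_ofReal.1 ((hasSum_mul_left_iff h2I).1 hsum)

theorem integrableOn_mul_exp_neg_mul {c : ℝ} (hc : 0 < c) :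
    IntegrableOn (fun x : ℝ => x * exp (-(c * x))) (Ioi 0) := by
  simpa using integrableOn_rpow_mul_exp_neg_mul_rpow (p := 1) (s := 1) (b := c) (by norm_num)
    one_pos hc

theorem integral_mul_exp_neg_mul {c : ℝ} (hc : 0 < c) :
    ∫ x in Ioi (0 : ℝ), x * exp (-(c * x)) = 1 / c ^ 2 := by
  have h := integral_rpow_mul_exp_neg_mul_Ioi (a := 2) two_pos hc
  rw [Gamma_two] at h
  norm_num at h
  rw [h, one_div]

theorem abs_sin_mul_le {t x : ℝ} (ht : 0 ≤ t) (hx : 0 ≤ x) : |sin (t * x)| ≤ t * x :=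
  (abs_sin_le_abs (x := t * x)).trans_eq (abs_of_nonneg (by positivity))

theorem integrableOn_sin_mul_exp_neg_mul (t : ℝ) {c : ℝ} (hc : 0 < c) :
    IntegrableOn (fun x : ℝ => sin (t * x) * exp (-(c * x))) (Ioi 0) := by
  refine Integrable.mono' (g := fun x => exp (-(c * x))) ?_ ?_ ?_
  · simpa [IntegrableOn] using integrableOn_exp_mul_Ioi (neg_lt_zero.2 hc) 0
  · exact (by fun_prop : Measurable fun x : ℝ => sin (t * x) * exp (-(c * x))).aestronglyMeasurable
  · refine Eventually.of_forall fun x => ?_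
    rw [norm_mul, norm_of_nonneg (exp_pos _).le]
    exact mul_le_of_le_one_left (exp_pos _).le (abs_sin_le_one _)

theorem integral_sin_mul_exp_neg_mul (t : ℝ) {c : ℝ} (hc : 0 < c) :
    ∫ x in Ioi (0 : ℝ), sin (t * x) * exp (-(c * x)) = t / (t ^ 2 + c ^ 2) := by
  have hne : t ^ 2 + c ^ 2 ≠ 0 := by positivity
  have h := integral_Ioi_of_hasDerivAt_of_tendsto' (a := 0) (m := 0)
    (f := fun x : ℝ => exp (-(c * x)) * (-(c * sin (t * x) + t * cos (t * x)) / (t ^ 2 + c ^ 2)))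
    (f' := fun x => sin (t * x) * exp (-(c * x))) ?_ (integrableOn_sin_mul_exp_neg_mul t hc) ?_
  · rw [h]; simp; ring
  · intro x _
    have h1 : HasDerivAt (fun x : ℝ => t * x) t x := by simpa using (hasDerivAt_id x).const_mul t
    have h2 : HasDerivAt (fun x : ℝ => -(c * x)) (-c) x :=
      (((hasDerivAt_id x).const_mul c).neg).congr_deriv (by simp)
    refine (h2.exp.mul ((((h1.sin.const_mul c).add (h1.cos.const_mul t)).neg).div_const
      (t ^ 2 + c ^ 2))).congr_deriv ?_
    simp only [Pi.neg_apply, Pi.add_apply]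
    field_simp
    ring
  · refine Tendsto.zero_mul_isBoundedUnder_le ?_ ?_
    · refine tendsto_exp_neg_atTop_nhds_zero.comp (tendsto_id.const_mul_atTop hc)
    · refine isBoundedUnder_of ⟨(c + |t|) / (t ^ 2 + c ^ 2), fun x => ?_⟩
      rw [Function.comp, norm_div, norm_neg, norm_of_nonneg (by positivity : 0 ≤ t ^ 2 + c ^ 2)]
      gcongr
      refine (norm_add_le _ _).trans ?_
      rw [norm_mul, norm_mul, norm_of_nonneg hc.le]
      have h1 := mul_le_mul_of_nonneg_left (abs_sin_le_one (t * x)) hc.le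
      have h2 := mul_le_mul_of_nonneg_left (abs_cos_le_one (t * x)) (abs_nonneg t)
      simp only [norm_eq_abs]
      linarith

theorem hasSum_alternating {g : ℕ → ℝ} {S T : ℝ} (hS : HasSum g S)
    (hT : HasSum (fun k => g (2 * k + 1)) T) :
    HasSum (fun n => (-1) ^ n * g n) (S - 2 * T) := by
  have hE : HasSum (fun k => g (2 * k)) (S - T) := by
    have hs : Summable fun k => g (2 * k) :=
      hS.summable.comp_injective (mul_right_injective₀ two_ne_zero)
    have := (hs.hasSum.even_add_odd hT).unique hS
    rw [← this, add_sub_cancel_right]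
    exact hs.hasSum
  rw [show S - 2 * T = (S - T) + -T by ring]
  refine HasSum.even_add_odd ?_ ?_
  · simpa [pow_mul] using hE
  · simpa [pow_mul, pow_succ] using hT.neg

theorem hasSum_fermi {y : ℝ} (hy : 0 < y) :
    HasSum (fun n : ℕ => (-1) ^ n * exp (-((n + 1) * y))) (1 / (exp y + 1)) := by
  have h := (hasSum_geometric_of_norm_lt_one (ξ := -exp (-y))
    (by simpa using hy)).mul_left (exp (-y))
  convert! h using 1
  · ext n
    rw [neg_pow (exp (-y)), ← exp_nat_mul, mul_left_comm, ← exp_add]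
    congr 2; ring
  · have : 1 + exp (-y) ≠ 0 := by positivity
    rw [sub_neg_eq_add, ← div_eq_mul_inv, div_eq_div_iff (by positivity) this, mul_add (exp (-y)),
      ← exp_add]
    simp [add_comm]

/-- The sine transform of the Fermi weight `1 / (exp (πx/2) + 1)`. -/
noncomputable def fermiSine (t : ℝ) : ℝ :=
  ∫ x in Ioi (0 : ℝ), sin (t * x) / (exp (π / 2 * x) + 1)

theorem fermiSine_eq {t : ℝ} (ht : 0 < t) :
    fermiSine t = 1 / (2 * t) - 1 / sinh (2 * t) := by
  have hpi := pi_pos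
  have hc : ∀ n : ℕ, 0 < (n + 1) * (π / 2) := fun n => by positivity
  set g : ℕ → ℝ := fun n => t / (t ^ 2 + ((n + 1) * (π / 2)) ^ 2) with hg
  have hS : HasSum g (cosh (2 * t) / sinh (2 * t) - 1 / (2 * t)) := by
    have h := (hasSum_div_sq_add_sq (z := 2 * t / π) (by positivity)).mul_left (2 / π)
    convert! h using 1
    · ext n
      simp only [hg]
      field_simp
    · rw [mul_div_cancel₀ _ hpi.ne']
      field_simp
  have hT : HasSum (fun k => g (2 * k + 1))
      ((cosh t / sinh t - 1 / t) / 2) := by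
    have h := (hasSum_div_sq_add_sq (z := t / π) (by positivity)).mul_left (1 / π)
    convert! h using 1
    · ext n
      simp only [hg]
      push_cast
      field_simp
      ring
    · rw [mul_div_cancel₀ _ hpi.ne']
      field_simp
  have hsum := hasSum_alternating hS hT
  have hint := hasSum_integral_of_summable_integral_norm
    (μ := volume.restrict (Ioi (0 : ℝ)))
    (F := fun (n : ℕ) (x : ℝ) => (-1) ^ n * (sin (t * x) * exp (-((n + 1) * (π / 2) * x))))
    (fun n => (integrableOn_sin_mul_exp_neg_mul t (hc n)).const_mul _) ?_
  · have h1 : ∫ x in Ioi (0 : ℝ), (∑' n : ℕ,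
        (-1) ^ n * (sin (t * x) * exp (-((n + 1) * (π / 2) * x)))) = fermiSine t := by
      refine setIntegral_congr_fun measurableSet_Ioi fun x hx => ?_
      have hx : 0 < x := hx
      have h := (hasSum_fermi (y := π / 2 * x) (by positivity)).mul_left (sin (t * x))
      have h' := h.tsum_eq
      rw [mul_one_div] at h'
      rw [← h']
      refine tsum_congr fun n => ?_
      rw [mul_assoc ((n : ℝ) + 1)]
      ring
    rw [h1] at hint
    simp only [integral_const_mul, integral_sin_mul_exp_neg_mul t (hc _)] at hint
    rw [hint.unique hsum]
    have h2 : sinh t ≠ 0 := (sinh_pos_iff.2 ht).ne'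
    have h3 : cosh t ≠ 0 := (cosh_pos t).ne'
    rw [sinh_two_mul, cosh_two_mul]
    field_simp
    linear_combination (-t) * cosh_sq t
  · have hb : Summable fun n : ℕ => t * (1 / ((n + 1) * (π / 2)) ^ 2) := by
      have := ((summable_nat_add_iff 1).2 (summable_one_div_nat_pow.2 one_lt_two)).mul_left
        (t * (1 / (π / 2) ^ 2))
      refine this.congr fun n => ?_
      push_cast
      field_simp
    refine hb.of_nonneg_of_le (fun n => integral_nonneg fun x => norm_nonneg _) fun n => ?_
    rw [← integral_mul_exp_neg_mul (hc n), ← integral_const_mul]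
    refine setIntegral_mono_on ((integrableOn_sin_mul_exp_neg_mul t (hc n)).const_mul _).norm
      ((integrableOn_mul_exp_neg_mul (hc n)).const_mul t) measurableSet_Ioi fun x hx => ?_
    have hx : 0 < x := hx
    rw [norm_mul, norm_mul, norm_pow, norm_neg, norm_one, one_pow, one_mul,
      norm_of_nonneg (exp_pos _).le, ← mul_assoc]
    gcongr
    exact abs_sin_mul_le ht.le hx.le

theorem summable_pow_div_factorial_succ (R : ℝ) :
    Summable fun k : ℕ => R ^ k / ((k + 1).factorial : ℝ) := by
  refine Summable.of_norm_bounded (Real.summable_pow_div_factorial R).norm fun k => ?_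
  rw [norm_div, norm_div, norm_natCast, norm_natCast]
  have := k.factorial_pos
  gcongr
  exact k.le_succ

theorem hasDerivAt_tsum_pow_div (t : ℝ) :
    HasDerivAt (fun t : ℝ => ∑' k : ℕ, t ^ (k + 1) / (((k + 1) * (k + 1).factorial : ℕ) : ℝ))
      (∑' k : ℕ, t ^ k / ((k + 1).factorial : ℝ)) t := by
  refine hasDerivAt_tsum_of_isPreconnected (summable_pow_div_factorial_succ (|t| + 1))
    (g := fun (k : ℕ) (t : ℝ) => t ^ (k + 1) / (((k + 1) * (k + 1).factorial : ℕ) : ℝ))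
    (g' := fun (k : ℕ) (t : ℝ) => t ^ k / ((k + 1).factorial : ℝ))
    (t := Metric.ball (0 : ℝ) (|t| + 1)) (y₀ := 0) Metric.isOpen_ball
    (convex_ball _ _).isPreconnected (fun k y _ => ?_) (fun k y hy => ?_)
    (Metric.mem_ball_self (by positivity))
    (by simp)
    (mem_ball_zero_iff.2 (lt_add_one ‖t‖))
  · refine ((hasDerivAt_pow (k + 1) y).div_const _).congr_deriv ?_
    push_cast
    have : ((k + 1).factorial : ℝ) ≠ 0 := by positivity
    field_simp
  · rw [norm_div, norm_pow, Real.norm_natCast]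
    gcongr
    simpa using (mem_ball_zero_iff.1 hy).le

theorem tsum_pow_div_factorial_succ {t : ℝ} (ht : t ≠ 0) :
    ∑' k : ℕ, t ^ k / ((k + 1).factorial : ℝ) = (exp t - 1) / t := by
  have h := (hasSum_nat_add_iff' 1).2 (NormedSpace.expSeries_div_hasSum_exp t)
  rw [← Real.exp_eq_exp_ℝ] at h
  have h2 := (h.div_const t).tsum_eq
  simp only [Finset.range_one, Finset.sum_singleton, pow_zero, Nat.factorial_zero,
    Nat.cast_one, div_one] at h2
  rw [← h2]
  refine tsum_congr fun k => ?_
  field_simp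
  ring

theorem tendsto_log_one_sub_exp_neg_sub_log :
    Tendsto (fun s : ℝ => log (1 - exp (-s)) - log s) (𝓝[>] 0) (𝓝 0) := by
  have h : HasDerivAt (fun s : ℝ => 1 - exp (-s)) 1 0 := by
    refine ((hasDerivAt_neg (0 : ℝ)).exp.const_sub 1).congr_deriv (by simp)
  have h2 := h.tendsto_slope_zero_right
  have h3 := (continuousAt_log one_ne_zero).tendsto.comp h2
  rw [log_one] at h3
  refine h3.congr' ?_
  filter_upwards [self_mem_nhdsWithin] with s hs
  have hs : 0 < s := hs
  have : 0 < 1 - exp (-s) := by simpa using hs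
  simp only [Function.comp, zero_add, neg_zero, exp_zero, sub_self, sub_zero, smul_eq_mul]
  rw [log_mul (inv_ne_zero hs.ne') this.ne', log_inv]
  ring

theorem integrableOn_fermi :
    IntegrableOn (fun x : ℝ => 1 / (exp (π / 2 * x) + 1)) (Ioi 0) := by
  refine Integrable.mono' (g := fun x => exp (-(π / 2) * x)) ?_ ?_ ?_
  · exact integrableOn_exp_mul_Ioi (neg_lt_zero.2 (by positivity)) 0
  · exact (by fun_prop : Measurable fun x : ℝ => 1 / (exp (π / 2 * x) + 1)).aestronglyMeasurable
  · refine Eventually.of_forall fun x => ?_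
    rw [norm_of_nonneg (by positivity), neg_mul, exp_neg, ← one_div]
    gcongr
    linarith

theorem norm_sin_div_fermi_le (t x : ℝ) :
    ‖sin (t * x) / (exp (π / 2 * x) + 1)‖ ≤ 1 / (exp (π / 2 * x) + 1) := by
  rw [norm_div, norm_of_nonneg (by positivity : 0 ≤ exp (π / 2 * x) + 1)]
  gcongr
  exact abs_sin_le_one _

theorem measurable_sin_div_fermi (t : ℝ) :
    Measurable fun x : ℝ => sin (t * x) / (exp (π / 2 * x) + 1) := by
  fun_prop

theorem continuous_fermiSine : Continuous fermiSine := by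
  refine continuous_of_dominated (bound := fun x : ℝ => 1 / (exp (π / 2 * x) + 1))
    (fun t => (measurable_sin_div_fermi t).aestronglyMeasurable)
    (fun t => Eventually.of_forall (norm_sin_div_fermi_le t)) integrableOn_fermi
    (Eventually.of_forall fun x => by fun_prop)

theorem norm_fermiSine_le (t : ℝ) :
    ‖fermiSine t‖ ≤ ∫ x in Ioi (0 : ℝ), 1 / (exp (π / 2 * x) + 1) :=
  norm_integral_le_of_norm_le integrableOn_fermi (Eventually.of_forall (norm_sin_div_fermi_le t))

theorem fermiSine_neg (t : ℝ) : fermiSine (-t) = -fermiSine t := by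
  simp only [fermiSine, neg_mul, sin_neg, neg_div, integral_neg]

theorem integrableOn_exp_neg_mul_fermiSine (a : ℝ) :
    IntegrableOn (fun t => exp (-t) * fermiSine t) (Ioi a) :=
  (integrableOn_exp_neg_Ioi a).mul_bdd continuous_fermiSine.aestronglyMeasurable
    (Eventually.of_forall norm_fermiSine_le)

theorem integral_shift_Ioi (f : ℝ → ℝ) (s : ℝ) :
    ∫ u in Ioi (0 : ℝ), f (u + s) = ∫ t in Ioi s, f t := by
  have := (measurePreserving_add_right volume s).setIntegral_preimage_emb
    (measurableEmbedding_addRight s) f (Ioi s)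
  simpa using this

theorem integral_exp_neg_mul_sin (x : ℝ) :
    ∫ u in Ioi (0 : ℝ), exp (-u) * sin (x * u) = x / (1 + x ^ 2) := by
  have := integral_sin_mul_exp_neg_mul x one_pos
  simp only [one_mul, one_pow] at this
  rw [add_comm, ← this]
  simp only [mul_comm]

theorem cosineTransform_eq_integral_fermiSine (s : ℝ) :
    ∫ x in Ioi (0 : ℝ), cos (s * x) * x * exp (-π * x / 4) / ((1 + x ^ 2) * cosh (π * x / 4)) =
      ∫ u in Ioi (0 : ℝ), (exp (-u) * fermiSine (u + s) + exp (-u) * fermiSine (u - s)) := by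
  set W : ℝ → ℝ := fun x => 1 / (exp (π / 2 * x) + 1) with hW
  have hint : Integrable (Function.uncurry fun x u : ℝ =>
      W x * exp (-u) * (2 * (cos (s * x) * sin (x * u))))
      ((volume.restrict (Ioi 0)).prod (volume.restrict (Ioi 0))) := by
    refine (integrableOn_fermi.mul_prod (integrableOn_exp_neg_Ioi 0)).mul_bdd (c := 2) ?_ ?_
    · exact (by fun_prop : Measurable fun p : ℝ × ℝ =>
        2 * (cos (s * p.1) * sin (p.1 * p.2))).aestronglyMeasurable
    · refine Eventually.of_forall fun p => ?_
      rw [norm_mul, norm_mul, norm_ofNat]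
      have := mul_le_one₀ (abs_cos_le_one (s * p.1)) (abs_nonneg _) (abs_sin_le_one (p.1 * p.2))
      simp only [norm_eq_abs]
      linarith
  have hswap := integral_integral_swap hint
  have hleft : ∀ x : ℝ, ∫ u in Ioi (0 : ℝ), W x * exp (-u) * (2 * (cos (s * x) * sin (x * u))) =
      cos (s * x) * x * exp (-π * x / 4) / ((1 + x ^ 2) * cosh (π * x / 4)) := by
    intro x
    have h1 : ∀ u : ℝ, W x * exp (-u) * (2 * (cos (s * x) * sin (x * u))) =
        (2 * W x * cos (s * x)) * (exp (-u) * sin (x * u)) := fun u => by ring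
    have h2 : exp (π / 2 * x) = exp (π * x / 4) ^ 2 := by
      rw [← exp_nat_mul]; congr 1; push_cast; ring
    rw [integral_congr_ae (Eventually.of_forall h1), integral_const_mul,
      integral_exp_neg_mul_sin]
    simp only [hW]
    rw [h2, cosh_eq, show -π * x / 4 = -(π * x / 4) by ring, exp_neg]
    have := exp_pos (π * x / 4)
    field_simp
  have hright : ∀ u : ℝ, ∫ x in Ioi (0 : ℝ), W x * exp (-u) * (2 * (cos (s * x) * sin (x * u))) =
      exp (-u) * fermiSine (u + s) + exp (-u) * fermiSine (u - s) := by
    intro u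
    have hi : ∀ t, IntegrableOn (fun x => sin (t * x) / (exp (π / 2 * x) + 1)) (Ioi 0) := fun t =>
      Integrable.mono' integrableOn_fermi (measurable_sin_div_fermi t).aestronglyMeasurable
        (Eventually.of_forall (norm_sin_div_fermi_le t))
    rw [← mul_add, fermiSine, fermiSine, ← integral_add (hi _) (hi _), ← integral_const_mul]
    refine integral_congr_ae (Eventually.of_forall fun x => ?_)
    simp only [hW]
    rw [add_mul, sub_mul, sin_add, sin_sub, mul_comm x u]
    ring
  simpa only [hleft, hright] using hswap

theorem cosineTransform_eq (s : ℝ) :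
    ∫ x in Ioi (0 : ℝ), cos (s * x) * x * exp (-π * x / 4) / ((1 + x ^ 2) * cosh (π * x / 4)) =
      exp s * (∫ t in Ioi s, exp (-t) * fermiSine t) +
        exp (-s) * ((∫ t in Ioi (0 : ℝ), exp (-t) * fermiSine t) -
          ∫ t in (0 : ℝ)..s, exp t * fermiSine t) := by
  have hshift : ∀ s u : ℝ, exp (-u) * fermiSine (u + s) =
      exp s * (exp (-(u + s)) * fermiSine (u + s)) := fun s u => by
    rw [← mul_assoc, ← exp_add]
    congr 2
    ring
  have hint : ∀ s, IntegrableOn (fun u => exp (-u) * fermiSine (u + s)) (Ioi 0) := fun s =>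
    (integrableOn_exp_neg_Ioi 0).mul_bdd
      (continuous_fermiSine.comp (continuous_add_const s)).aestronglyMeasurable
      (Eventually.of_forall fun u => norm_fermiSine_le _)
  have hval : ∀ s, ∫ u in Ioi (0 : ℝ), exp (-u) * fermiSine (u + s) =
      exp s * ∫ t in Ioi s, exp (-t) * fermiSine t := fun s => by
    simp only [hshift s]
    rw [integral_const_mul, integral_shift_Ioi (fun t => exp (-t) * fermiSine t)]
  have hneg : ∫ t in (-s)..0, exp (-t) * fermiSine t = -∫ t in (0 : ℝ)..s, exp t * fermiSine t := by
    have h := intervalIntegral.integral_comp_neg (a := 0) (b := s)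
      (fun t => exp (-t) * fermiSine t)
    rw [neg_zero] at h
    rw [← h, ← intervalIntegral.integral_neg]
    simp [fermiSine_neg]
  rw [cosineTransform_eq_integral_fermiSine]
  simp only [sub_eq_add_neg _ s]
  rw [integral_add (hint _) (hint _), hval, hval, ← intervalIntegral.integral_interval_add_Ioi
    (integrableOn_exp_neg_mul_fermiSine (-s)) (integrableOn_exp_neg_mul_fermiSine 0), hneg]
  ring

theorem fermiSine_eq_exp {t : ℝ} (ht : 0 < t) :
    fermiSine t = 1 / (2 * t) - 2 * exp (-t) ^ 2 / (1 - exp (-t) ^ 4) := by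
  have h1 : exp (-t) < 1 := by simpa using ht
  have h0 := exp_pos (-t)
  have h4 : 0 < 1 - exp (-t) ^ 4 := by
    have := pow_lt_one₀ h0.le h1 four_ne_zero
    linarith
  rw [fermiSine_eq ht, sinh_eq, show -(2 * t) = -t + -t by ring, show 2 * t = t + t by ring,
    exp_add, exp_add, show exp t = (exp (-t))⁻¹ by rw [exp_neg, inv_inv]]
  congr 1
  field_simp

/-- The inverse hyperbolic tangent of `exp (-t)`. -/
noncomputable def artanhExpNeg (t : ℝ) : ℝ :=
  (log (1 + exp (-t)) - log (1 - exp (-t))) / 2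

theorem hasDerivAt_artanhExpNeg {t : ℝ} (ht : 0 < t) :
    HasDerivAt artanhExpNeg (-exp (-t) / (1 - exp (-t) ^ 2)) t := by
  have h1 : exp (-t) < 1 := by simpa using ht
  have h0 := exp_pos (-t)
  have hp : 1 + exp (-t) ≠ 0 := by positivity
  have hm : 1 - exp (-t) ≠ 0 := by linarith
  have hd := (hasDerivAt_neg t).exp
  refine ((((hd.const_add 1).log hp).sub ((hd.const_sub 1).log hm)).div_const 2).congr_deriv ?_
  have : 1 - exp (-t) ^ 2 ≠ 0 := by
    rw [show 1 - exp (-t) ^ 2 = (1 + exp (-t)) * (1 - exp (-t)) by ring]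
    exact mul_ne_zero hp hm
  field_simp
  ring

theorem hasDerivAt_arctan_exp_neg (t : ℝ) :
    HasDerivAt (fun t => arctan (exp (-t))) (-exp (-t) / (1 + exp (-t) ^ 2)) t := by
  refine ((hasDerivAt_neg t).exp.arctan).congr_deriv ?_
  ring

theorem tendsto_exp_neg_nhdsGT_zero : Tendsto (fun t : ℝ => exp (-t)) (𝓝[>] 0) (𝓝 1) := by
  have : ContinuousAt (fun t : ℝ => exp (-t)) 0 := by fun_prop
  simpa using this.tendsto.mono_left nhdsWithin_le_nhds

theorem tendsto_arctan_exp_neg :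
    Tendsto (fun t : ℝ => arctan (exp (-t))) (𝓝[>] 0) (𝓝 (π / 4)) := by
  rw [← arctan_one]
  exact (continuous_arctan.tendsto 1).comp tendsto_exp_neg_nhdsGT_zero

theorem tendsto_artanhExpNeg_add_log :
    Tendsto (fun t => artanhExpNeg t + log t / 2) (𝓝[>] 0) (𝓝 (log 2 / 2)) := by
  have h1 : Tendsto (fun t : ℝ => log (1 + exp (-t))) (𝓝[>] 0) (𝓝 (log 2)) := by
    have := (tendsto_exp_neg_nhdsGT_zero.const_add 1).log (by norm_num)
    rwa [one_add_one_eq_two] at this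
  have := (h1.sub tendsto_log_one_sub_exp_neg_sub_log).div_const 2
  rw [sub_zero] at this
  refine this.congr fun t => ?_
  rw [artanhExpNeg]
  ring

theorem tendsto_artanhExpNeg_sub_arctan_atTop :
    Tendsto (fun t => artanhExpNeg t - arctan (exp (-t))) atTop (𝓝 0) := by
  have hw := tendsto_exp_neg_atTop_nhds_zero
  have h1 := (hw.const_add 1).log (by norm_num)
  have h2 := (hw.const_sub 1).log (by norm_num)
  have h3 := (continuous_arctan.tendsto 0).comp hw
  simpa [artanhExpNeg, Function.comp_def] using ((h1.sub h2).div_const 2).sub h3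

theorem integral_Ioi_exp_neg_mul_fermiSine {s : ℝ} (hs : 0 < s) :
    ∫ t in Ioi s, exp (-t) * fermiSine t =
      (∫ t in Ioi s, exp (-t) / t) / 2 - artanhExpNeg s + arctan (exp (-s)) := by
  have hderiv : ∀ t ∈ Ici s, HasDerivAt (fun t => artanhExpNeg t - arctan (exp (-t)))
      (exp (-t) * fermiSine t - exp (-t) / t / 2) t := by
    intro t ht
    have ht : 0 < t := hs.trans_le ht
    refine ((hasDerivAt_artanhExpNeg ht).sub (hasDerivAt_arctan_exp_neg t)).congr_deriv ?_
    have h1 : exp (-t) < 1 := by simpa using ht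
    have h0 := exp_pos (-t)
    have h2 : 0 < 1 - exp (-t) ^ 2 := by nlinarith
    rw [fermiSine_eq_exp ht, show 1 - exp (-t) ^ 4 =
      (1 - exp (-t) ^ 2) * (1 + exp (-t) ^ 2) by ring]
    field_simp
    ring
  have hi1 := integrableOn_exp_neg_mul_fermiSine s
  have hi2 := (integrableOn_exp_neg_div hs).div_const 2
  have h := integral_Ioi_of_hasDerivAt_of_tendsto' hderiv (hi1.sub hi2)
    tendsto_artanhExpNeg_sub_arctan_atTop
  rw [integral_sub hi1 hi2, integral_div] at h
  linarith

theorem integral_Ioi_zero_exp_neg_mul_fermiSine :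
    ∫ t in Ioi (0 : ℝ), exp (-t) * fermiSine t =
      -eulerMascheroniConstant / 2 - log 2 / 2 + π / 4 := by
  have h1 : Tendsto (fun s : ℝ => ∫ t in Ioi s, exp (-t) * fermiSine t) (𝓝[>] 0)
      (𝓝 (∫ t in Ioi (0 : ℝ), exp (-t) * fermiSine t)) :=
    ((integrableOn_exp_neg_mul_fermiSine 0).continuousOn_Ici_primitive_Ioi 0
      self_mem_Ici).tendsto.mono_left (nhdsWithin_mono _ Ioi_subset_Ici_self)
  refine tendsto_nhds_unique h1 ?_
  refine (((tendsto_expIntegral_add_log.div_const 2).sub tendsto_artanhExpNeg_add_log).add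
    tendsto_arctan_exp_neg).congr' ?_
  filter_upwards [self_mem_nhdsWithin] with s hs
  rw [integral_Ioi_exp_neg_mul_fermiSine hs]
  ring

theorem Ei_of_pos {t : ℝ} (ht : 0 < t) : Ei t = eulerMascheroniConstant + log t +
    ∑' k : ℕ, t ^ (k + 1) / (((k + 1) * (k + 1).factorial : ℕ) : ℝ) := by
  rw [Ei, if_neg ht.not_gt]

theorem hasDerivAt_Ei {t : ℝ} (ht : 0 < t) : HasDerivAt Ei (exp t / t) t := by
  have h := ((hasDerivAt_log ht.ne').const_add eulerMascheroniConstant).add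
    (hasDerivAt_tsum_pow_div t)
  rw [tsum_pow_div_factorial_succ ht.ne'] at h
  refine (h.congr_of_eventuallyEq ?_).congr_deriv (by field_simp; ring)
  filter_upwards [lt_mem_nhds ht] with x hx
  exact Ei_of_pos hx

theorem tendsto_Ei_sub_log :
    Tendsto (fun t => Ei t - log t) (𝓝[>] 0) (𝓝 eulerMascheroniConstant) := by
  have h := ((hasDerivAt_tsum_pow_div 0).continuousAt.tendsto.mono_left
    (nhdsWithin_le_nhds (s := Ioi 0))).const_add eulerMascheroniConstant
  simp only [ne_eq, Nat.succ_ne_zero, not_false_eq_true, zero_pow, zero_div, tsum_zero,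
    add_zero] at h
  refine h.congr' ?_
  filter_upwards [self_mem_nhdsWithin] with t ht
  rw [Ei_of_pos ht]
  ring

theorem integral_exp_mul_fermiSine {s : ℝ} (hs : 0 < s) :
    ∫ t in (0 : ℝ)..s, exp t * fermiSine t =
      Ei s / 2 + artanhExpNeg s + arctan (exp (-s)) -
        (eulerMascheroniConstant / 2 + log 2 / 2 + π / 4) := by
  have hderiv : ∀ t, 0 < t → HasDerivAt (fun t => Ei t / 2 + artanhExpNeg t + arctan (exp (-t)))
      (exp t * fermiSine t) t := by
    intro t ht
    refine ((((hasDerivAt_Ei ht).div_const 2).add (hasDerivAt_artanhExpNeg ht)).add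
      (hasDerivAt_arctan_exp_neg t)).congr_deriv ?_
    have h1 : exp (-t) < 1 := by simpa using ht
    have h0 := exp_pos (-t)
    have h2 : 0 < 1 - exp (-t) ^ 2 := by nlinarith
    rw [fermiSine_eq_exp ht, show 1 - exp (-t) ^ 4 =
      (1 - exp (-t) ^ 2) * (1 + exp (-t) ^ 2) by ring,
      show exp t = (exp (-t))⁻¹ by rw [exp_neg, inv_inv]]
    field_simp
    ring
  refine intervalIntegral.integral_eq_sub_of_hasDerivAt_of_tendsto hs
    (fun t ht => hderiv t ht.1)
    ((continuous_exp.mul continuous_fermiSine).intervalIntegrable _ _) ?_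
    ((hderiv s hs).continuousAt.tendsto.mono_left nhdsWithin_le_nhds)
  refine (((tendsto_Ei_sub_log.div_const 2).add tendsto_artanhExpNeg_add_log).add
    tendsto_arctan_exp_neg).congr fun t => ?_
  ring

/-- For every `s > 0`,
`∫_0^∞ cos(sx) x e^{-πx/4}/((1+x²) cosh(πx/4)) dx
  = (π/2) e^{-s} + 2 sinh(s) arctan(e^{-s}) - cosh(s) log(1+e^{-s})
    - (e^{-s}/2)(Ei(s) - log(1-e^{-s})) - (e^{s}/2)(Ei(-s) - log(1-e^{-s}))`. -/
theorem cosineTransform_tanh_khintchine (s : ℝ) (hs : 0 < s) :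
    ∫ x in Set.Ioi (0 : ℝ), Real.cos (s * x) * x * Real.exp (-Real.pi * x / 4) /
        ((1 + x ^ 2) * Real.cosh (Real.pi * x / 4)) =
      Real.pi / 2 * Real.exp (-s) + 2 * Real.sinh s * Real.arctan (Real.exp (-s))
        - Real.cosh s * Real.log (1 + Real.exp (-s))
        - Real.exp (-s) / 2 * (Ei s - Real.log (1 - Real.exp (-s)))
        - Real.exp s / 2 * (Ei (-s) - Real.log (1 - Real.exp (-s))) := by
  have hEi : Ei (-s) = -∫ t in Ioi s, Real.exp (-t) / t := by
    rw [Ei, if_pos (neg_lt_zero.2 hs), neg_neg]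
  rw [cosineTransform_eq, integral_Ioi_exp_neg_mul_fermiSine hs,
    integral_Ioi_zero_exp_neg_mul_fermiSine, integral_exp_mul_fermiSine hs, hEi, artanhExpNeg,
    sinh_eq, cosh_eq]
  ring
end

section
/- For every real t > 0, i·( (t²/2)·ζ(2, t/2) - (t²/4)·ζ(2, t/4) + 1 ) = ∫_ℝ (1 + itx)/(it - x) · (π/4)·x²·cosh(π|x|/2) / ((1 + x²)·sinh²(π|x|/2)) dx, where ζ(2, a) := Σ_{k=0}^∞ 1/(k + a)² for a > 0 and the integrals are complex-valued. -/
/-- The Hurwitz zeta function at `s = 2`: `ζ(2, a) = Σ_{k=0}^∞ 1/(k+a)²`. -/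
noncomputable def hurwitzZetaTwo (a : ℝ) : ℝ := ∑' k : ℕ, 1 / ((k : ℝ) + a) ^ 2

section

open Real Set Filter Topology MeasureTheory

lemma hasDerivAt_arctan_div {t : ℝ} (ht : 0 < t) (x : ℝ) :
    HasDerivAt (fun x => arctan (x / t) / t) (1 / (x ^ 2 + t ^ 2)) x := by
  have h := (((hasDerivAt_id x).div_const t).arctan).div_const t
  refine h.congr_deriv ?_
  have : t ^ 2 + x ^ 2 ≠ 0 := by positivity
  have : x ^ 2 + t ^ 2 ≠ 0 := by positivity
  simp only [id]
  field_simp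
  ring

lemma tendsto_arctan_div {t : ℝ} (ht : 0 < t) :
    Tendsto (fun x => arctan (x / t) / t) atTop (𝓝 (π / 2 / t)) :=
  ((tendsto_nhds_of_tendsto_nhdsWithin tendsto_arctan_atTop).comp
    (tendsto_id.atTop_div_const ht)).div_const t

lemma tendsto_div_sq_add_sq (t : ℝ) :
    Tendsto (fun x : ℝ => x / (x ^ 2 + t ^ 2)) atTop (𝓝 0) := by
  refine squeeze_zero' ?_ ?_ tendsto_inv_atTop_zero
  · filter_upwards [eventually_gt_atTop 0] with x hx
    positivity
  · filter_upwards [eventually_gt_atTop 0] with x hx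
    rw [inv_eq_one_div, div_le_div_iff₀ (by positivity) hx]
    nlinarith [sq_nonneg t]

lemma hasDerivAt_div_sq_add_sq {t : ℝ} (ht : 0 < t) (x : ℝ) :
    HasDerivAt (fun x : ℝ => x / (x ^ 2 + t ^ 2))
      ((t ^ 2 - x ^ 2) / (x ^ 2 + t ^ 2) ^ 2) x := by
  have hx : x ^ 2 + t ^ 2 ≠ 0 := by positivity
  refine ((hasDerivAt_id x).div ((hasDerivAt_pow 2 x).add_const (t ^ 2)) hx).congr_deriv ?_
  simp only [id]
  congr 1
  ring

lemma integrable_one_div_sq_add_sq {t : ℝ} (ht : 0 < t) :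
    Integrable (fun x : ℝ => 1 / (x ^ 2 + t ^ 2)) := by
  have h := (integrable_inv_one_add_sq.comp_div ht.ne').const_mul (1 / t ^ 2)
  refine h.congr (ae_of_all _ fun x => ?_)
  have : x ^ 2 + t ^ 2 ≠ 0 := by positivity
  have : t ^ 2 + x ^ 2 ≠ 0 := by positivity
  simp only
  field_simp
  ring

/-- A primitive of `1 / (x² + t²)²`. -/
lemma hasDerivAt_primitive_one_div_sq {t : ℝ} (ht : 0 < t) (x : ℝ) :
    HasDerivAt (fun x : ℝ => 1 / (2 * t ^ 2) * (x / (x ^ 2 + t ^ 2) + arctan (x / t) / t))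
      (1 / (x ^ 2 + t ^ 2) ^ 2) x := by
  refine (((hasDerivAt_div_sq_add_sq ht x).add (hasDerivAt_arctan_div ht x)).const_mul
    (1 / (2 * t ^ 2))).congr_deriv ?_
  have : x ^ 2 + t ^ 2 ≠ 0 := by positivity
  field_simp
  ring

lemma tendsto_primitive_one_div_sq {t : ℝ} (ht : 0 < t) :
    Tendsto (fun x : ℝ => 1 / (2 * t ^ 2) * (x / (x ^ 2 + t ^ 2) + arctan (x / t) / t))
      atTop (𝓝 (1 / (2 * t ^ 2) * (0 + π / 2 / t))) :=
  ((tendsto_div_sq_add_sq t).add (tendsto_arctan_div ht)).const_mul _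

lemma integrableOn_and_integral_one_div_sq {t : ℝ} (ht : 0 < t) :
    IntegrableOn (fun x : ℝ => 1 / (x ^ 2 + t ^ 2) ^ 2) (Ioi 0) ∧
      ∫ x in Ioi (0 : ℝ), 1 / (x ^ 2 + t ^ 2) ^ 2 = π / (4 * t ^ 3) := by
  have hd := fun x (_ : x ∈ Ici (0 : ℝ)) => hasDerivAt_primitive_one_div_sq ht x
  have hn : ∀ x ∈ Ioi (0 : ℝ), 0 ≤ 1 / (x ^ 2 + t ^ 2) ^ 2 := fun x _ => by positivity
  refine ⟨integrableOn_Ioi_deriv_of_nonneg' hd hn (tendsto_primitive_one_div_sq ht), ?_⟩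
  rw [integral_Ioi_of_hasDerivAt_of_nonneg' hd hn (tendsto_primitive_one_div_sq ht)]
  simp
  field_simp
  norm_num

lemma integrableOn_and_integral_sq_div {a t : ℝ} (ha : 0 < a) (ht : 0 < t) :
    IntegrableOn (fun x : ℝ => x ^ 2 / ((x ^ 2 + a ^ 2) * (x ^ 2 + t ^ 2) ^ 2)) (Ioi 0) ∧
      ∫ x in Ioi (0 : ℝ), x ^ 2 / ((x ^ 2 + a ^ 2) * (x ^ 2 + t ^ 2) ^ 2)
        = π / (4 * t * (t + a) ^ 2) := by
  have hn : ∀ x ∈ Ioi (0 : ℝ), 0 ≤ x ^ 2 / ((x ^ 2 + a ^ 2) * (x ^ 2 + t ^ 2) ^ 2) :=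
    fun x _ => by positivity
  suffices h : ∃ F : ℝ → ℝ, F 0 = 0 ∧
      (∀ x ∈ Ici (0 : ℝ), HasDerivAt F (x ^ 2 / ((x ^ 2 + a ^ 2) * (x ^ 2 + t ^ 2) ^ 2)) x) ∧
      Tendsto F atTop (𝓝 (π / (4 * t * (t + a) ^ 2))) by
    obtain ⟨F, h0, hd, hl⟩ := h
    refine ⟨integrableOn_Ioi_deriv_of_nonneg' hd hn hl, ?_⟩
    rw [integral_Ioi_of_hasDerivAt_of_nonneg' hd hn hl, h0, sub_zero]
  rcases eq_or_ne a t with rfl | hat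
  · refine ⟨fun x => 1 / (8 * a ^ 2) * (arctan (x / a) / a + x / (x ^ 2 + a ^ 2)
      - 2 * a ^ 2 * (x / (x ^ 2 + a ^ 2) * (1 / (x ^ 2 + a ^ 2)))), by simp, fun x _ => ?_, ?_⟩
    · have hx : x ^ 2 + a ^ 2 ≠ 0 := by positivity
      have h1 : HasDerivAt (fun x : ℝ => 1 / (x ^ 2 + a ^ 2))
          (-(2 * x) / (x ^ 2 + a ^ 2) ^ 2) x := by
        refine ((hasDerivAt_const x (1 : ℝ)).div
          (((hasDerivAt_id x).pow 2).add_const (a ^ 2)) hx).congr_deriv ?_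
        simp
      refine ((((hasDerivAt_arctan_div ha x).add (hasDerivAt_div_sq_add_sq ha x)).sub
        (((hasDerivAt_div_sq_add_sq ha x).mul h1).const_mul (2 * a ^ 2))).const_mul
        (1 / (8 * a ^ 2))).congr_deriv ?_
      field_simp
      ring
    · have h1 : Tendsto (fun x : ℝ => 1 / (x ^ 2 + a ^ 2)) atTop (𝓝 0) := by
        refine Tendsto.div_atTop tendsto_const_nhds ?_
        exact tendsto_atTop_add_const_right _ _ (tendsto_pow_atTop two_ne_zero)
      convert ((((tendsto_arctan_div ha).add (tendsto_div_sq_add_sq a)).sub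
        (((tendsto_div_sq_add_sq a).mul h1).const_mul (2 * a ^ 2))).const_mul
        (1 / (8 * a ^ 2))) using 2
      field_simp
      ring
  · have hs : t ^ 2 - a ^ 2 ≠ 0 := by
      rw [sq_sub_sq]
      exact mul_ne_zero (by positivity) (sub_ne_zero.2 hat.symm)
    refine ⟨fun x => a ^ 2 / (t ^ 2 - a ^ 2) ^ 2 * (arctan (x / t) / t - arctan (x / a) / a)
      + t ^ 2 / (t ^ 2 - a ^ 2) *
        (1 / (2 * t ^ 2) * (x / (x ^ 2 + t ^ 2) + arctan (x / t) / t)), by simp, fun x _ => ?_, ?_⟩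
    · refine ((((hasDerivAt_arctan_div ht x).sub (hasDerivAt_arctan_div ha x)).const_mul
        (a ^ 2 / (t ^ 2 - a ^ 2) ^ 2)).add
        ((hasDerivAt_primitive_one_div_sq ht x).const_mul (t ^ 2 / (t ^ 2 - a ^ 2)))).congr_deriv ?_
      have : x ^ 2 + t ^ 2 ≠ 0 := by positivity
      have : x ^ 2 + a ^ 2 ≠ 0 := by positivity
      field_simp
      ring
    · convert (((tendsto_arctan_div ht).sub (tendsto_arctan_div ha)).const_mul
        (a ^ 2 / (t ^ 2 - a ^ 2) ^ 2)).add
        ((tendsto_primitive_one_div_sq ht).const_mul (t ^ 2 / (t ^ 2 - a ^ 2))) using 2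
      have h1 : t - a ≠ 0 := sub_ne_zero.2 hat.symm
      have h2 : t + a ≠ 0 := by positivity
      rw [sq_sub_sq]
      field_simp
      ring

lemma hasSum_coth {x : ℝ} (hx : 0 < x) :
    HasSum (fun n : ℕ => 2 * x / (x ^ 2 + ((n : ℝ) + 1) ^ 2))
      (π * (cosh (π * x) / sinh (π * x)) - 1 / x) := by
  have hz : Complex.I * x ∈ Complex.integerComplement := by
    rintro ⟨n, hn⟩
    have := congrArg Complex.im hn
    simp at this
    exact hx.ne this
  have h := (Summable.hasSum_iff (summable_cotTerm hz)).2 (cot_series_rep' hz).symm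
  have h2 := h.mul_left Complex.I
  rw [← Complex.hasSum_ofReal]
  have hI := Complex.I_sq
  have hxc : (x : ℂ) ≠ 0 := by exact_mod_cast hx.ne'
  convert h2 using 1
  · rfl
  · funext n
    have h3 : (x : ℂ) ^ 2 + ((n : ℂ) + 1) ^ 2 ≠ 0 := by
      have : x ^ 2 + ((n : ℝ) + 1) ^ 2 ≠ 0 := by positivity
      exact_mod_cast this
    have e : (x : ℂ) ^ 2 + ((n : ℂ) + 1) ^ 2 =
        -((Complex.I * x - (n + 1)) * (Complex.I * x + (n + 1))) := by
      linear_combination (x : ℂ) ^ 2 * hI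
    have h4 : Complex.I * x - (n + 1) ≠ 0 := fun h0 => h3 (by rw [e, h0]; ring)
    have h5 : Complex.I * x + (n + 1) ≠ 0 := fun h0 => h3 (by rw [e, h0]; ring)
    push_cast
    rw [cotTerm, e, one_div_add_one_div h4 h5, mul_div_assoc', div_neg, ← neg_div]
    congr 1
    linear_combination -2 * (x : ℂ) * hI
  · have hs : (sinh (π * x) : ℂ) ≠ 0 := by
      have : sinh (π * x) ≠ 0 := (sinh_pos_iff.2 (by positivity)).ne'
      exact_mod_cast this
    push_cast at hs ⊢
    rw [show (π : ℂ) * (Complex.I * x) = (π * x) * Complex.I by ring, Complex.cot,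
      Complex.cos_mul_I, Complex.sin_mul_I]
    field_simp

/-- The Mittag-Leffler expansion of `coth`, rescaled. -/
lemma hasSum_coth_div {b x : ℝ} (hb : 0 < b) (hx : 0 < x) :
    HasSum (fun n : ℕ => 2 * x / (x ^ 2 + (b * ((n : ℝ) + 1)) ^ 2))
      (π / b * (cosh (π * x / b) / sinh (π * x / b)) - 1 / x) := by
  have h := (hasSum_coth (div_pos hx hb)).mul_left (1 / b)
  have hs : sinh (π * x / b) ≠ 0 := (sinh_pos_iff.2 (by positivity)).ne'
  convert h using 1
  · rfl
  · funext n
    have : x ^ 2 + (b * ((n : ℝ) + 1)) ^ 2 ≠ 0 := by positivity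
    have : x ^ 2 + b ^ 2 * ((n : ℝ) + 1) ^ 2 ≠ 0 := by positivity
    field_simp
  · rw [mul_div_assoc]
    field_simp

lemma summable_one_div_add_sq {a : ℝ} (ha : 0 < a) :
    Summable (fun k : ℕ => 1 / ((k : ℝ) + a) ^ 2) := by
  have := (Real.summable_one_div_nat_add_rpow a 2).2 (by norm_num)
  refine this.congr fun k => ?_
  rw [abs_of_pos (by positivity)]
  norm_cast

lemma hasSum_one_div_add_mul_sq {b t : ℝ} (hb : 0 < b) (ht : 0 < t) :
    HasSum (fun n : ℕ => 1 / (t + b * ((n : ℝ) + 1)) ^ 2)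
      (hurwitzZetaTwo (t / b) / b ^ 2 - 1 / t ^ 2) := by
  have h := ((summable_one_div_add_sq (div_pos ht hb)).hasSum.div_const (b ^ 2))
  rw [← hasSum_nat_add_iff' 1] at h
  convert h using 1
  · rfl
  · funext n
    push_cast
    field_simp
    ring
  · simp [hurwitzZetaTwo]
    field_simp

lemma integrableOn_and_integral_coth {b t : ℝ} (hb : 0 < b) (ht : 0 < t) :
    IntegrableOn (fun x : ℝ => x / (x ^ 2 + t ^ 2) ^ 2 * (cosh (π * x / b) / sinh (π * x / b)))
      (Ioi 0) ∧
    ∫ x in Ioi (0 : ℝ), x / (x ^ 2 + t ^ 2) ^ 2 * (cosh (π * x / b) / sinh (π * x / b)) =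
      hurwitzZetaTwo (t / b) / (2 * b * t) - b / (4 * t ^ 3) := by
  set f : ℕ → ℝ → ℝ := fun n x =>
    x ^ 2 / ((x ^ 2 + (b * ((n : ℝ) + 1)) ^ 2) * (x ^ 2 + t ^ 2) ^ 2) with hf
  have hint (n : ℕ) := integrableOn_and_integral_sq_div (a := b * ((n : ℝ) + 1)) (by positivity) ht
  have hsum : HasSum (fun n => ∫ x in Ioi (0 : ℝ), f n x)
      (π / (4 * t) * (hurwitzZetaTwo (t / b) / b ^ 2 - 1 / t ^ 2)) := by
    convert (hasSum_one_div_add_mul_sq hb ht).mul_left (π / (4 * t)) using 1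
    · rfl
    funext n
    rw [(hint n).2]
    field_simp
  have hnorm : Summable fun n => ∫ x in Ioi (0 : ℝ), ‖f n x‖ := by
    refine hsum.summable.congr fun n => integral_congr_ae (ae_of_all _ fun x => ?_)
    exact (Real.norm_of_nonneg (by simp only [hf]; positivity)).symm
  have hpt : ∀ x ∈ Ioi (0 : ℝ), HasSum (fun n => f n x)
      (π / (2 * b) * (x / (x ^ 2 + t ^ 2) ^ 2 * (cosh (π * x / b) / sinh (π * x / b)))
        - 1 / 2 * (1 / (x ^ 2 + t ^ 2) ^ 2)) := by
    intro x hx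
    have hx : 0 < x := hx
    have hs : sinh (π * x / b) ≠ 0 := (sinh_pos_iff.2 (by positivity)).ne'
    convert (hasSum_coth_div hb hx).mul_left (x / (2 * (x ^ 2 + t ^ 2) ^ 2)) using 1
    · rfl
    · funext n
      simp only [hf]
      have : x ^ 2 + (b * ((n : ℝ) + 1)) ^ 2 ≠ 0 := by positivity
      field_simp
    · field_simp
  have hInt := hasSum_integral_of_summable_integral_norm (fun n => (hint n).1) hnorm
  have hG := hInt.unique hsum
  have hGint : IntegrableOn (fun x => ∑' n, f n x) (Ioi 0) := by
    refine Integrable.of_integral_ne_zero ?_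
    rw [← hInt.tsum_eq]
    refine (hInt.summable.tsum_pos (fun n => ?_) 0 ?_).ne'
    · rw [(hint n).2]
      positivity
    · rw [(hint 0).2]
      positivity
  obtain ⟨hqint, hq⟩ := integrableOn_and_integral_one_div_sq ht
  have hEq : EqOn (fun x => 2 * b / π * ((∑' n, f n x) + 1 / 2 * (1 / (x ^ 2 + t ^ 2) ^ 2)))
      (fun x => x / (x ^ 2 + t ^ 2) ^ 2 * (cosh (π * x / b) / sinh (π * x / b))) (Ioi 0) := by
    intro x hx
    simp only
    rw [(hpt x hx).tsum_eq]
    have := pi_pos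
    field_simp
    ring
  have hI := (hGint.add (hqint.const_mul (1 / 2))).const_mul (2 * b / π)
  refine ⟨IntegrableOn.congr_fun hI hEq measurableSet_Ioi, ?_⟩
  rw [← setIntegral_congr_fun measurableSet_Ioi hEq, integral_const_mul,
    integral_add hGint (hqint.const_mul (1 / 2)), integral_const_mul, hG, hq]
  have := pi_pos
  field_simp
  ring

lemma sq_mul_cosh_le {y : ℝ} (hy : 0 ≤ y) : y ^ 2 * cosh y ≤ 5 * sinh y ^ 2 := by
  have h1 : y ≤ sinh y := self_le_sinh_iff.2 hy
  have h2 : cosh y ≤ 1 + sinh y := by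
    have := cosh_sub_sinh y
    have : exp (-y) ≤ 1 := exp_le_one_iff.2 (by linarith)
    linarith
  have h3 : y ^ 2 ≤ 4 * sinh y := by
    have := quadratic_le_exp_of_nonneg hy
    have := cosh_add_sinh y
    nlinarith
  calc y ^ 2 * cosh y ≤ y ^ 2 * (1 + sinh y) := by gcongr
    _ = y ^ 2 + y ^ 2 * sinh y := by ring
    _ ≤ sinh y ^ 2 + 4 * sinh y * sinh y := by
      have : 0 ≤ sinh y := hy.trans h1
      gcongr
    _ = 5 * sinh y ^ 2 := by ring

lemma integrable_sq_mul_cosh_div {t : ℝ} (ht : 0 < t) :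
    Integrable (fun x : ℝ => |x| ^ 2 * cosh (π * |x| / 2) /
      ((|x| ^ 2 + t ^ 2) * sinh (π * |x| / 2) ^ 2)) := by
  refine ((integrable_one_div_sq_add_sq ht).const_mul (20 / π ^ 2)).mono'
    (Measurable.aestronglyMeasurable (by fun_prop)) (ae_of_all _ fun x => ?_)
  rw [Real.norm_of_nonneg (by have := cosh_pos (π * |x| / 2); positivity)]
  rcases eq_or_ne x 0 with rfl | hx
  · simp
    positivity
  have hx' : 0 < |x| := abs_pos.2 hx
  have hs : 0 < sinh (π * |x| / 2) := sinh_pos_iff.2 (by positivity)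
  have h := sq_mul_cosh_le (y := π * |x| / 2) (by positivity)
  rw [← sq_abs x, div_mul_div_comm, div_le_div_iff₀ (by positivity) (by positivity)]
  have : |x| ^ 2 * cosh (π * |x| / 2) * π ^ 2 ≤ 20 * sinh (π * |x| / 2) ^ 2 := by
    linarith [h]
  nlinarith [mul_le_mul_of_nonneg_right this (show 0 ≤ |x| ^ 2 + t ^ 2 by positivity)]

/-- Integration by parts. -/
lemma integral_sq_mul_cosh_div {t : ℝ} (ht : 0 < t) :
    ∫ x in Ioi (0 : ℝ), x ^ 2 * cosh (π * x / 2) / ((x ^ 2 + t ^ 2) * sinh (π * x / 2) ^ 2) =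
      4 * t ^ 2 / π * (hurwitzZetaTwo (t / 4) / (8 * t) - hurwitzZetaTwo (t / 2) / (4 * t)
        - 1 / (2 * t ^ 3)) := by
  obtain ⟨hi4, h4⟩ := integrableOn_and_integral_coth (b := 4) (by norm_num) ht
  obtain ⟨hi2, h2⟩ := integrableOn_and_integral_coth (b := 2) (by norm_num) ht
  have hi1 : IntegrableOn (fun x : ℝ => x ^ 2 * cosh (π * x / 2) /
      ((x ^ 2 + t ^ 2) * sinh (π * x / 2) ^ 2)) (Ioi 0) := by
    refine (integrable_sq_mul_cosh_div ht).integrableOn.congr_fun (fun x hx => ?_)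
      measurableSet_Ioi
    simp only [abs_of_pos (show 0 < x from hx)]
  have hid := (hi4.sub hi2).const_mul (4 * t ^ 2 / π)
  have hcsch : ∀ x ∈ Ioi (0 : ℝ), 1 / sinh (π * x / 2) =
      cosh (π * x / 4) / sinh (π * x / 4) - cosh (π * x / 2) / sinh (π * x / 2) := by
    intro x hx
    have hx : 0 < x := hx
    have hs : sinh (π * x / 4) ≠ 0 := (sinh_pos_iff.2 (by positivity)).ne'
    have hc := (cosh_pos (π * x / 4)).ne'
    rw [show π * x / 2 = 2 * (π * x / 4) by ring, sinh_two_mul, cosh_two_mul]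
    field_simp
    linear_combination (-1) * cosh_sq (π * x / 4)
  have hderiv : ∀ x ∈ Ioi (0 : ℝ), HasDerivAt
      (fun x => 2 / π * (x ^ 2 / (x ^ 2 + t ^ 2) * (1 / sinh (π * x / 2))))
      (4 * t ^ 2 / π * (x / (x ^ 2 + t ^ 2) ^ 2 * (cosh (π * x / 4) / sinh (π * x / 4)) -
        x / (x ^ 2 + t ^ 2) ^ 2 * (cosh (π * x / 2) / sinh (π * x / 2))) -
        x ^ 2 * cosh (π * x / 2) / ((x ^ 2 + t ^ 2) * sinh (π * x / 2) ^ 2)) x := by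
    intro x hx
    have hx0 : 0 < x := hx
    have hs : sinh (π * x / 2) ≠ 0 := (sinh_pos_iff.2 (by positivity)).ne'
    have hq : x ^ 2 + t ^ 2 ≠ 0 := by positivity
    have hp := pi_pos
    have hl : HasDerivAt (fun x : ℝ => π * x / 2) (π * 1 / 2) x :=
      ((hasDerivAt_id x).const_mul π).div_const 2
    rw [← mul_sub, ← hcsch x hx]
    refine ((((hasDerivAt_pow 2 x).div ((hasDerivAt_pow 2 x).add_const (t ^ 2)) hq).mul
      ((hasDerivAt_const x (1 : ℝ)).div hl.sinh hs)).const_mul (2 / π)).congr_deriv ?_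
    simp only [Pi.div_apply]
    field_simp
    ring
  have hbound : ∀ x ∈ Ioi (0 : ℝ),
      0 ≤ 2 / π * (x ^ 2 / (x ^ 2 + t ^ 2) * (1 / sinh (π * x / 2))) ∧
      2 / π * (x ^ 2 / (x ^ 2 + t ^ 2) * (1 / sinh (π * x / 2))) ≤
        4 / π ^ 2 * (x / (x ^ 2 + t ^ 2)) := by
    intro x hx
    have hx0 : 0 < x := hx
    have hp := pi_pos
    have hs : 0 < sinh (π * x / 2) := sinh_pos_iff.2 (by positivity)
    have hy : π * x / 2 ≤ sinh (π * x / 2) := self_le_sinh_iff.2 (by positivity)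
    refine ⟨by positivity, ?_⟩
    calc _ ≤ 2 / π * (x ^ 2 / (x ^ 2 + t ^ 2) * (1 / (π * x / 2))) := by gcongr
      _ = _ := by field_simp; norm_num
  have hlim0 : Tendsto (fun x : ℝ => 4 / π ^ 2 * (x / (x ^ 2 + t ^ 2))) (𝓝[>] 0) (𝓝 0) := by
    have : ContinuousAt (fun x : ℝ => 4 / π ^ 2 * (x / (x ^ 2 + t ^ 2))) 0 :=
      (hasDerivAt_div_sq_add_sq ht 0).continuousAt.const_mul _
    simpa using this.tendsto.mono_left nhdsWithin_le_nhds
  have hliminf : Tendsto (fun x : ℝ => 4 / π ^ 2 * (x / (x ^ 2 + t ^ 2))) atTop (𝓝 0) := by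
    simpa using (tendsto_div_sq_add_sq t).const_mul (4 / π ^ 2)
  have hftc := integral_Ioi_of_hasDerivAt_of_tendsto
    (a := 0) (m := 0)
    (f := fun x => 2 / π * (x ^ 2 / (x ^ 2 + t ^ 2) * (1 / sinh (π * x / 2)))) ?_
    hderiv (hid.sub hi1) ?_
  · simp only [Pi.sub_apply] at hftc hid
    rw [integral_sub hid hi1, integral_const_mul, integral_sub hi4 hi2, h4, h2] at hftc
    norm_num at hftc
    rw [← sub_eq_zero.1 hftc]
    field_simp
    ring
  · rw [← continuousWithinAt_Ioi_iff_Ici]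
    unfold ContinuousWithinAt
    norm_num
    refine tendsto_of_tendsto_of_tendsto_of_le_of_le' tendsto_const_nhds hlim0 ?_ ?_
    · filter_upwards [self_mem_nhdsWithin] with x hx
      simpa using (hbound x hx).1
    · filter_upwards [self_mem_nhdsWithin] with x hx
      simpa using (hbound x hx).2
  · refine tendsto_of_tendsto_of_tendsto_of_le_of_le' tendsto_const_nhds hliminf ?_ ?_
    · filter_upwards [eventually_gt_atTop 0] with x hx using (hbound x hx).1
    · filter_upwards [eventually_gt_atTop 0] with x hx using (hbound x hx).2

end

/-- For every `t > 0`,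
`i((t²/2) ζ(2, t/2) - (t²/4) ζ(2, t/4) + 1)
  = ∫_ℝ (1 + itx)/(it - x) · (π/4) x² cosh(π|x|/2)/((1+x²) sinh²(π|x|/2)) dx`. -/
theorem voiculescu_bdcf_cosh_representation (t : ℝ) (ht : 0 < t) :
    Complex.I * (((t : ℂ) ^ 2 / 2) * (hurwitzZetaTwo (t / 2) : ℂ)
        - ((t : ℂ) ^ 2 / 4) * (hurwitzZetaTwo (t / 4) : ℂ) + 1) =
      ∫ x : ℝ, (1 + Complex.I * t * x) / (Complex.I * t - x) *
        ((Real.pi / 4 * x ^ 2 * Real.cosh (Real.pi * |x| / 2) /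
            ((1 + x ^ 2) * Real.sinh (Real.pi * |x| / 2) ^ 2) : ℝ) : ℂ) := by
  set E : ℝ → ℝ := fun x => |x| ^ 2 * Real.cosh (Real.pi * |x| / 2) /
      ((|x| ^ 2 + t ^ 2) * Real.sinh (Real.pi * |x| / 2) ^ 2) with hE
  have hEint : MeasureTheory.Integrable E := integrable_sq_mul_cosh_div ht
  set O : ℝ → ℝ := fun x => x / (1 + x ^ 2) * E x with hO
  have hOint : MeasureTheory.Integrable O := by
    refine hEint.bdd_mul (c := 1) (Measurable.aestronglyMeasurable (by fun_prop))
      (Filter.Eventually.of_forall fun x => ?_)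
    rw [Real.norm_eq_abs, abs_div, abs_of_pos (show 0 < 1 + x ^ 2 by positivity),
      div_le_one (by positivity), ← sq_abs]
    nlinarith [sq_nonneg (|x| - 1), abs_nonneg x]
  have hOzero : ∫ x, O x = 0 := by
    have h := MeasureTheory.integral_neg_eq_self O MeasureTheory.volume
    have hodd : ∀ x, O (-x) = -O x := fun x => by simp [hO, hE, neg_div]
    simp only [hodd, MeasureTheory.integral_neg] at h
    linarith
  have hEval := integral_comp_abs (f := fun x => x ^ 2 * Real.cosh (Real.pi * x / 2) /
      ((x ^ 2 + t ^ 2) * Real.sinh (Real.pi * x / 2) ^ 2))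
  rw [integral_sq_mul_cosh_div ht] at hEval
  have hsplit : ∀ x : ℝ, (1 + Complex.I * t * x) / (Complex.I * t - x) *
        ((Real.pi / 4 * x ^ 2 * Real.cosh (Real.pi * |x| / 2) /
            ((1 + x ^ 2) * Real.sinh (Real.pi * |x| / 2) ^ 2) : ℝ) : ℂ) =
      ((Real.pi / 4 * (t ^ 2 - 1) * O x : ℝ) : ℂ) +
        Complex.I * ((-(Real.pi / 4 * t) * E x : ℝ) : ℂ) := by
    intro x
    have hq : (x : ℂ) ^ 2 + (t : ℂ) ^ 2 ≠ 0 := by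
      have : x ^ 2 + t ^ 2 ≠ 0 := by positivity
      exact_mod_cast this
    have h1 : (1 : ℂ) + (x : ℂ) ^ 2 ≠ 0 := by
      have : 1 + x ^ 2 ≠ 0 := by positivity
      exact_mod_cast this
    have hd : Complex.I * t - x ≠ 0 := fun h => hq (by
      linear_combination (-(Complex.I * t) - x) * h + (t : ℂ) ^ 2 * Complex.I_sq)
    have hk : (1 + Complex.I * t * x) / (Complex.I * t - x) =
        (((t : ℂ) ^ 2 - 1) * x - Complex.I * t * (1 + (x : ℂ) ^ 2)) /
          ((x : ℂ) ^ 2 + (t : ℂ) ^ 2) := by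
      rw [div_eq_div_iff hd hq]
      linear_combination (t : ℂ) ^ 2 * (1 + (x : ℂ) ^ 2) * Complex.I_sq
    rw [hk]
    simp only [hO, hE, sq_abs]
    generalize Real.cosh (Real.pi * |x| / 2) = c
    generalize Real.sinh (Real.pi * |x| / 2) = s
    push_cast
    rcases eq_or_ne (s : ℂ) 0 with hs | hs
    · simp [hs]
    · field_simp
      ring
  simp only [hsplit]
  rw [MeasureTheory.integral_add (hOint.const_mul _).ofReal
      ((hEint.const_mul _).ofReal.const_mul _),
    MeasureTheory.integral_const_mul, integral_complex_ofReal, integral_complex_ofReal,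
    MeasureTheory.integral_const_mul, MeasureTheory.integral_const_mul, hOzero, hE, hEval]
  have ht' : (t : ℂ) ≠ 0 := by exact_mod_cast ht.ne'
  have hp : (Real.pi : ℂ) ≠ 0 := by exact_mod_cast Real.pi_ne_zero
  push_cast
  field_simp
  ring
end

section
/- For every real t ≥ 0, (π/2)·∫_0^∞ cos(tx) · x²·cosh(πx/2) / ((1 + x²)·sinh²(πx/2)) dx = -1 - t·tanh(t) + 2·cosh(t)·( ∫_0^{e^t} arctan(v)/v dv - t·arctan(e^t) ). -/
namespace CoshTransform

open MeasureTheory Filter Topology Set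

/-- The Mittag-Leffler expansion of the hyperbolic cotangent. -/
theorem hasSum_coth {t : ℝ} (ht : t ≠ 0) :
    HasSum (fun n : ℕ ↦ 2 * t / (t ^ 2 + (Real.pi * (n + 1)) ^ 2))
      (Real.cosh t / Real.sinh t - 1 / t) := by
  have hpi : (Real.pi : ℂ) ≠ 0 := by exact_mod_cast Real.pi_ne_zero
  have htc : (t : ℂ) ≠ 0 := by exact_mod_cast ht
  set x : ℂ := t * Complex.I / Real.pi with hx_def
  have hx : x ∈ Complex.integerComplement := by
    rintro ⟨n, hn⟩
    have := congrArg Complex.im hn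
    rw [hx_def, Complex.div_ofReal_im] at this
    simp only [Complex.intCast_im, Complex.mul_im, Complex.ofReal_re, Complex.ofReal_im,
      Complex.I_im, Complex.I_re, mul_one, mul_zero, add_zero] at this
    exact div_ne_zero ht Real.pi_ne_zero this.symm
  have hs : HasSum (fun n : ℕ ↦ cotTerm x n) (Real.pi * Complex.cot (Real.pi * x) - 1 / x) := by
    rw [cot_series_rep' hx]
    exact (summable_cotTerm hx).hasSum
  have hs' := hs.mul_left (Complex.I / Real.pi)
  have hsinh : Complex.sinh t ≠ 0 := by
    exact_mod_cast (Real.sinh_ne_zero.mpr ht)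
  have hval : Complex.I / Real.pi * (Real.pi * Complex.cot (Real.pi * x) - 1 / x) =
      ((Real.cosh t / Real.sinh t - 1 / t : ℝ) : ℂ) := by
    have : Real.pi * x = t * Complex.I := by rw [hx_def]; field_simp
    rw [this, Complex.cot, Complex.cos_mul_I, Complex.sin_mul_I, hx_def]
    push_cast
    field_simp
  have hterm (n : ℕ) : Complex.I / Real.pi * cotTerm x n =
      ((2 * t / (t ^ 2 + (Real.pi * (n + 1)) ^ 2) : ℝ) : ℂ) := by
    have h1 : x + (n + 1) ≠ 0 := by
      exact_mod_cast Complex.integerComplement_add_ne_zero hx (n + 1)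
    have h2 : x - (n + 1) ≠ 0 := by
      have := Complex.integerComplement_add_ne_zero hx (-(n + 1))
      push_cast at this
      rwa [← sub_eq_add_neg] at this
    have h3 : ((t : ℂ) ^ 2 + (Real.pi * (n + 1)) ^ 2) ≠ 0 := by
      have : 0 < t ^ 2 + (Real.pi * (n + 1)) ^ 2 := by positivity
      exact_mod_cast this.ne'
    have h4 : ((t : ℂ) ^ 2 + (Real.pi * (n + 1)) ^ 2) =
        -(Real.pi ^ 2 * ((x - (n + 1)) * (x + (n + 1)))) := by
      rw [hx_def]
      field_simp
      ring_nf
      simp only [Complex.I_sq]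
      ring
    push_cast
    rw [h4, cotTerm, div_add_div _ _ h2 h1, div_mul_div_comm, div_eq_div_iff]
    · have : Complex.I * x * Real.pi = -t := by
        rw [hx_def]; field_simp; rw [Complex.I_sq]; 
      linear_combination (-2 * Real.pi * ((x - (n + 1)) * (x + (n + 1)))) * this
    · simp [hpi, h1, h2]
    · simp [hpi, h1, h2]
  simp only [hterm, hval] at hs'
  exact_mod_cast hs'

/-- The Mittag-Leffler expansion of the hyperbolic tangent. -/
theorem hasSum_mul_tanh (t : ℝ) :
    HasSum (fun n : ℕ ↦ 2 * t ^ 2 / (((2 * n + 1) * Real.pi / 2) ^ 2 + t ^ 2))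
      (t * Real.tanh t) := by
  rcases eq_or_ne t 0 with rfl | ht
  · simp
  have hodd := hasSum_coth ht
  have hall := (hasSum_coth (t := 2 * t) (by simpa using ht)).mul_left 2
  set f : ℕ → ℝ := fun n ↦ 2 * (2 * (2 * t) / ((2 * t) ^ 2 + (Real.pi * (n + 1)) ^ 2)) with hf
  have heven : Summable (fun k : ℕ ↦ f (2 * k)) :=
    hall.summable.comp_injective (mul_right_injective₀ two_ne_zero)
  have hodd' : HasSum (fun k : ℕ ↦ f (2 * k + 1)) (Real.cosh t / Real.sinh t - 1 / t) := by
    convert hodd using 2 with k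
    simp only [hf]
    push_cast
    rw [mul_div_assoc', div_eq_div_iff (by positivity) (by positivity)]
    ring
  have h := (heven.hasSum.even_add_odd hodd').unique hall
  have hsinh : Real.sinh t ≠ 0 := Real.sinh_ne_zero.mpr ht
  have hcosh := (Real.cosh_pos t).ne'
  have hval : ∑' k : ℕ, f (2 * k) = Real.tanh t := by
    rw [eq_sub_of_add_eq h, Real.sinh_two_mul, Real.cosh_two_mul, Real.tanh_eq_sinh_div_cosh]
    field_simp
    ring
  have hterm (k : ℕ) :
      2 * t ^ 2 / (((2 * k + 1) * Real.pi / 2) ^ 2 + t ^ 2) = t * f (2 * k) := by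
    simp only [hf]
    push_cast
    rw [mul_div_assoc', mul_div_assoc', div_eq_div_iff (by positivity) (by positivity)]
    ring
  simp_rw [hterm]
  exact (hval ▸ heven.hasSum).mul_left t

/-- The kernel `(π/2) cosh(πx/2) / sinh²(πx/2)`. -/
noncomputable def coshKernel (x : ℝ) : ℝ :=
  Real.pi / 2 * Real.cosh (Real.pi * x / 2) / Real.sinh (Real.pi * x / 2) ^ 2

theorem coshKernel_nonneg (x : ℝ) : 0 ≤ coshKernel x := by
  have := Real.cosh_pos (Real.pi * x / 2)
  unfold coshKernel
  positivity

theorem measurable_coshKernel : Measurable coshKernel := by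
  unfold coshKernel
  have h1 := Real.continuous_cosh.measurable
  have h2 := Real.continuous_sinh.measurable
  fun_prop

/-- The expansion of `coshKernel` in exponentials. -/
theorem hasSum_coshKernel {x : ℝ} (hx : 0 < x) :
    HasSum (fun n : ℕ ↦ (2 * n + 1) * Real.pi * Real.exp (-((2 * n + 1) * Real.pi / 2) * x))
      (coshKernel x) := by
  set q := Real.exp (-(Real.pi * x / 2)) with hq
  have hq0 : 0 < q := Real.exp_pos _
  have hq1 : q < 1 := Real.exp_lt_one_iff.mpr (by have := Real.pi_pos; simp; positivity)
  have hr : ‖q ^ 2‖ < 1 := by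
    rw [Real.norm_of_nonneg (by positivity)]
    exact pow_lt_one₀ hq0.le hq1 two_ne_zero
  have h1 := hasSum_coe_mul_geometric_of_norm_lt_one hr
  have h2 := hasSum_geometric_of_norm_lt_one hr
  have h3 := ((h1.mul_left 2).add h2).mul_left (Real.pi * q)
  have hne : 1 - q ^ 2 ≠ 0 := by nlinarith
  have hval : coshKernel x = Real.pi * q * (2 * (q ^ 2 / (1 - q ^ 2) ^ 2) + (1 - q ^ 2)⁻¹) := by
    have hexp : Real.exp (Real.pi * x / 2) = q⁻¹ := by rw [hq, Real.exp_neg, inv_inv]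
    rw [coshKernel, Real.cosh_eq, Real.sinh_eq, hexp, ← hq]
    have : q⁻¹ - q ≠ 0 := by
      rw [show q⁻¹ - q = (1 - q ^ 2) / q by field_simp]
      exact div_ne_zero hne hq0.ne'
    have h5 : q⁻¹ - q = (1 - q ^ 2) / q := by field_simp
    rw [h5]
    field_simp
    ring
  rw [hval]
  have hterm (n : ℕ) : (2 * n + 1) * Real.pi * Real.exp (-((2 * n + 1) * Real.pi / 2) * x) =
      Real.pi * q * (2 * (n * (q ^ 2) ^ n) + (q ^ 2) ^ n) := by
    have : Real.exp (-((2 * n + 1) * Real.pi / 2) * x) = q * (q ^ 2) ^ n := by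
      rw [← pow_mul, ← pow_succ', hq, ← Real.exp_nat_mul]
      push_cast
      ring_nf
    rw [this]
    ring
  simp_rw [hterm]
  exact h3

/-- `∫₀^∞ (1 - cos(tx)) e^{-ax} dx = t² / (a (a² + t²))` for `a > 0`. -/
theorem integral_one_sub_cos_mul_exp {a : ℝ} (ha : 0 < a) (t : ℝ) :
    IntegrableOn (fun x ↦ (1 - Real.cos (t * x)) * Real.exp (-a * x)) (Ioi 0) ∧
      ∫ x in Ioi (0 : ℝ), (1 - Real.cos (t * x)) * Real.exp (-a * x) =
        t ^ 2 / (a * (a ^ 2 + t ^ 2)) := by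
  set z : ℂ := -a + t * Complex.I with hz
  have hre : z.re < 0 := by simp [hz, ha]
  have hzi := integrableOn_exp_mul_complex_Ioi hre 0
  have hz' := integral_exp_mul_complex_Ioi hre 0
  have hcos (x : ℝ) : (Complex.exp (z * x)).re = Real.cos (t * x) * Real.exp (-a * x) := by
    rw [Complex.exp_re]
    simp [hz, mul_comm]
  have hci : IntegrableOn (fun x ↦ Real.cos (t * x) * Real.exp (-a * x)) (Ioi 0) := by
    have h := hzi.re
    simpa only [RCLike.re_to_complex, hcos, IntegrableOn] using h
  have hcv : ∫ x in Ioi (0 : ℝ), Real.cos (t * x) * Real.exp (-a * x) = a / (a ^ 2 + t ^ 2) := by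
    simp_rw [← hcos, ← RCLike.re_to_complex]
    rw [integral_re hzi, hz']
    simp [hz, Complex.div_re, Complex.normSq_apply]
    field_simp
  have hei := integrableOn_exp_mul_Ioi (neg_lt_zero.mpr ha) 0
  have hev := integral_exp_mul_Ioi (neg_lt_zero.mpr ha) 0
  simp_rw [sub_mul, one_mul]
  refine ⟨hei.sub hci, ?_⟩
  rw [integral_sub hei hci, hev, hcv]
  simp
  field_simp
  ring

theorem integral_one_sub_cos_mul_coshKernel (t : ℝ) :
    ∫ x in Ioi (0 : ℝ), (1 - Real.cos (t * x)) * coshKernel x = t * Real.tanh t := by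
  set a : ℕ → ℝ := fun n ↦ (2 * n + 1) * Real.pi / 2 with ha_def
  have ha (n : ℕ) : 0 < a n := by have := Real.pi_pos; simp only [ha_def]; positivity
  set F : ℕ → ℝ → ℝ := fun n x ↦ 2 * a n * ((1 - Real.cos (t * x)) * Real.exp (-a n * x)) with hF
  have hFi (n : ℕ) : Integrable (F n) (volume.restrict (Ioi 0)) :=
    (integral_one_sub_cos_mul_exp (ha n) t).1.const_mul _
  have hFv (n : ℕ) : ∫ x in Ioi (0 : ℝ), F n x =
      2 * t ^ 2 / (((2 * n + 1) * Real.pi / 2) ^ 2 + t ^ 2) := by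
    have := ha n
    simp only [hF]
    rw [integral_const_mul, (integral_one_sub_cos_mul_exp (ha n) t).2]
    change _ = 2 * t ^ 2 / (a n ^ 2 + t ^ 2)
    field_simp
  have hFn (n : ℕ) (x : ℝ) : ‖F n x‖ = F n x := by
    have := ha n
    have := Real.cos_le_one (t * x)
    have := sub_nonneg.mpr this
    exact Real.norm_of_nonneg (by simp only [hF]; positivity)
  have hsum := hasSum_mul_tanh t
  have h := hasSum_integral_of_summable_integral_norm hFi
    (by simp_rw [hFn, hFv]; exact hsum.summable)
  simp_rw [hFv] at h
  rw [← h.unique hsum]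
  refine setIntegral_congr_fun measurableSet_Ioi fun x hx ↦ ?_
  have := ((hasSum_coshKernel hx).mul_left (1 - Real.cos (t * x))).tsum_eq
  rw [← this]
  refine tsum_congr fun n ↦ ?_
  simp only [hF, ha_def]
  ring

/-- The majorant `x² / (1 + x²) · coshKernel x`. -/
noncomputable def coshWeight (x : ℝ) : ℝ := x ^ 2 / (1 + x ^ 2) * coshKernel x

theorem coshWeight_nonneg (x : ℝ) : 0 ≤ coshWeight x :=
  mul_nonneg (by positivity) (coshKernel_nonneg x)

theorem sq_mul_coshKernel_le {x : ℝ} (hx : 0 < x) : x ^ 2 * coshKernel x ≤ 4 / Real.pi := by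
  have hpi := Real.pi_pos
  set z := Real.pi * x / 4 with hz
  have hz0 : 0 < z := by positivity
  have hy : Real.pi * x / 2 = 2 * z := by rw [hz]; ring
  have hx' : x = 4 * z / Real.pi := by rw [hz]; field_simp
  have h1 : z ≤ Real.sinh z := Real.self_le_sinh_iff.mpr hz0.le
  have hs : 0 < Real.sinh z := Real.sinh_pos_iff.mpr hz0
  have hc := Real.cosh_pos z
  have h2 := Real.cosh_sq z
  rw [coshKernel, hy, Real.sinh_two_mul, Real.cosh_two_mul, hx', mul_div_assoc',
    div_le_iff₀ (by positivity)]
  have h3 : z ^ 2 ≤ Real.sinh z ^ 2 := by gcongr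
  have h4 : z ^ 2 * (Real.cosh z ^ 2 + Real.sinh z ^ 2) ≤
      2 * (Real.sinh z ^ 2 * Real.cosh z ^ 2) := by
    have := mul_le_mul_of_nonneg_right h3 (by positivity : 0 ≤ Real.cosh z ^ 2 + Real.sinh z ^ 2)
    nlinarith [sq_nonneg (Real.sinh z)]
  calc (4 * z / Real.pi) ^ 2 * (Real.pi / 2 * (Real.cosh z ^ 2 + Real.sinh z ^ 2))
      = 8 / Real.pi * (z ^ 2 * (Real.cosh z ^ 2 + Real.sinh z ^ 2)) := by field_simp; ring
    _ ≤ 8 / Real.pi * (2 * (Real.sinh z ^ 2 * Real.cosh z ^ 2)) := by gcongr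
    _ = 4 / Real.pi * (2 * Real.sinh z * Real.cosh z) ^ 2 := by ring

theorem integrableOn_coshWeight : IntegrableOn coshWeight (Ioi 0) := by
  have hm : Measurable coshWeight := by
    have := measurable_coshKernel
    unfold coshWeight
    fun_prop
  refine Integrable.mono' ((integrable_inv_one_add_sq.const_mul (4 / Real.pi)).integrableOn)
    hm.aestronglyMeasurable ((ae_restrict_iff' measurableSet_Ioi).mpr (ae_of_all _ fun x hx ↦ ?_))
  rw [Real.norm_of_nonneg (coshWeight_nonneg x), coshWeight, div_mul_eq_mul_div, div_eq_mul_inv]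
  exact mul_le_mul_of_nonneg_right (sq_mul_coshKernel_le hx) (by positivity)

/-- The cosine transform of `coshWeight`. -/
noncomputable def coshTransform (t : ℝ) : ℝ :=
  ∫ x in Ioi (0 : ℝ), Real.cos (t * x) * coshWeight x

/-- The derivative of `coshPotential`, which is a primitive of `coshTransform`. -/
noncomputable def coshTransformPrimitive (t : ℝ) : ℝ :=
  ∫ x in Ioi (0 : ℝ), x * Real.sin (t * x) / (1 + x ^ 2) * coshKernel x

/-- A second primitive of `coshTransform`. -/
noncomputable def coshPotential (t : ℝ) : ℝ :=
  ∫ x in Ioi (0 : ℝ), (1 - Real.cos (t * x) / (1 + x ^ 2)) * coshKernel x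

theorem integrableOn_cos_mul_coshWeight (t : ℝ) :
    IntegrableOn (fun x ↦ Real.cos (t * x) * coshWeight x) (Ioi 0) :=
  integrableOn_coshWeight.bdd_mul (c := 1) (by fun_prop)
    (ae_of_all _ fun x ↦ Real.abs_cos_le_one _)

theorem abs_coshTransform_le (t : ℝ) :
    |coshTransform t| ≤ ∫ x in Ioi (0 : ℝ), coshWeight x := by
  rw [← Real.norm_eq_abs, coshTransform]
  refine norm_integral_le_of_norm_le integrableOn_coshWeight (ae_of_all _ fun x ↦ ?_)
  rw [norm_mul, Real.norm_of_nonneg (coshWeight_nonneg x)]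
  exact mul_le_of_le_one_left (coshWeight_nonneg x) (Real.abs_cos_le_one _)

theorem norm_coshTransformPrimitive_integrand_le (t x : ℝ) :
    ‖x * Real.sin (t * x) / (1 + x ^ 2) * coshKernel x‖ ≤ |t| * coshWeight x := by
  rw [norm_mul, Real.norm_of_nonneg (coshKernel_nonneg x), coshWeight, ← mul_assoc]
  refine mul_le_mul_of_nonneg_right ?_ (coshKernel_nonneg x)
  rw [norm_div, norm_mul, Real.norm_of_nonneg (by positivity : 0 ≤ 1 + x ^ 2), mul_div_assoc']
  refine div_le_div_of_nonneg_right ?_ (by positivity)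
  calc ‖x‖ * ‖Real.sin (t * x)‖ ≤ |x| * |t * x| :=
        mul_le_mul_of_nonneg_left Real.abs_sin_le_abs (abs_nonneg _)
    _ = |t| * x ^ 2 := by rw [abs_mul, ← sq_abs x]; ring

theorem integrableOn_coshPotential_integrand (t : ℝ) :
    IntegrableOn (fun x ↦ (1 - Real.cos (t * x) / (1 + x ^ 2)) * coshKernel x) (Ioi 0) := by
  have hk := measurable_coshKernel
  refine Integrable.mono' (integrableOn_coshWeight.const_mul (1 + t ^ 2 / 2))
    (by fun_prop) (ae_of_all _ fun x ↦ ?_)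
  have h : (0 : ℝ) < 1 + x ^ 2 := by positivity
  have h1 := Real.cos_le_one (t * x)
  have h2 := Real.one_sub_sq_div_two_le_cos (x := t * x)
  rw [norm_mul, Real.norm_of_nonneg (coshKernel_nonneg x), coshWeight, ← mul_assoc]
  refine mul_le_mul_of_nonneg_right ?_ (coshKernel_nonneg x)
  rw [one_sub_div h.ne', Real.norm_of_nonneg (div_nonneg (by nlinarith) h.le), mul_div_assoc']
  exact div_le_div_of_nonneg_right (by nlinarith) h.le

theorem hasDerivAt_coshPotential (t : ℝ) :
    HasDerivAt coshPotential (coshTransformPrimitive t) t := by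
  have hk := measurable_coshKernel
  refine (hasDerivAt_integral_of_dominated_loc_of_deriv_le (Metric.ball_mem_nhds t one_pos)
    (μ := volume.restrict (Ioi 0))
    (F := fun s x ↦ (1 - Real.cos (s * x) / (1 + x ^ 2)) * coshKernel x)
    (.of_forall fun s ↦ by fun_prop) (integrableOn_coshPotential_integrand t) (by fun_prop)
    (F' := fun s x ↦ x * Real.sin (s * x) / (1 + x ^ 2) * coshKernel x)
    (bound := fun x ↦ (|t| + 1) * coshWeight x)
    (ae_of_all _ fun x s hs ↦ ?_) (integrableOn_coshWeight.const_mul _)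
    (ae_of_all _ fun x s _ ↦ ?_)).2
  · refine (norm_coshTransformPrimitive_integrand_le s x).trans
      (mul_le_mul_of_nonneg_right ?_ (coshWeight_nonneg x))
    rw [Metric.mem_ball, Real.dist_eq] at hs
    linarith [abs_sub_abs_le_abs_sub s t]
  · have h : HasDerivAt (fun s ↦ s * x) x s := by simpa using (hasDerivAt_id s).mul_const x
    have := (((h.cos).div_const (1 + x ^ 2)).const_sub 1).mul_const (coshKernel x)
    convert! this using 1
    ring

theorem hasDerivAt_coshTransformPrimitive (t : ℝ) :
    HasDerivAt coshTransformPrimitive (coshTransform t) t := by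
  have hk := measurable_coshKernel
  have hi : IntegrableOn (fun x ↦ x * Real.sin (t * x) / (1 + x ^ 2) * coshKernel x) (Ioi 0) :=
    Integrable.mono' (integrableOn_coshWeight.const_mul |t|) (by fun_prop)
      (ae_of_all _ (norm_coshTransformPrimitive_integrand_le t))
  refine (hasDerivAt_integral_of_dominated_loc_of_deriv_le univ_mem
    (μ := volume.restrict (Ioi 0))
    (F := fun s x ↦ x * Real.sin (s * x) / (1 + x ^ 2) * coshKernel x)
    (.of_forall fun s ↦ by fun_prop) hi (integrableOn_cos_mul_coshWeight t).aestronglyMeasurable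
    (F' := fun s x ↦ Real.cos (s * x) * coshWeight x)
    (ae_of_all _ fun x s _ ↦ ?_) integrableOn_coshWeight (ae_of_all _ fun x s _ ↦ ?_)).2
  · rw [norm_mul, Real.norm_of_nonneg (coshWeight_nonneg x)]
    exact mul_le_of_le_one_left (coshWeight_nonneg x) (Real.abs_cos_le_one _)
  · have h : HasDerivAt (fun s ↦ s * x) x s := by simpa using (hasDerivAt_id s).mul_const x
    have := ((h.sin.const_mul x).div_const (1 + x ^ 2)).mul_const (coshKernel x)
    convert! this using 1
    rw [coshWeight]
    ring

theorem coshPotential_eq (t : ℝ) : coshPotential t = coshTransform t + t * Real.tanh t := by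
  rw [← integral_one_sub_cos_mul_coshKernel, eq_comm, ← eq_sub_iff_add_eq', coshPotential,
    coshTransform, ← integral_sub (integrableOn_coshPotential_integrand t)
      (integrableOn_cos_mul_coshWeight t)]
  refine integral_congr_ae (ae_of_all _ fun x ↦ ?_)
  have : 1 + x ^ 2 ≠ 0 := by positivity
  simp only [coshWeight]
  field_simp
  ring

theorem eq_mul_cosh_of_hasDerivAt {f g : ℝ → ℝ} (hf : ∀ t, HasDerivAt f (g t) t)
    (hg : ∀ t, HasDerivAt g (f t) t) (h0 : g 0 = 0) (t : ℝ) : f t = f 0 * Real.cosh t := by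
  have hconst {k : ℝ → ℝ} (hk : ∀ t, HasDerivAt k 0 t) : k t = k 0 :=
    is_const_of_deriv_eq_zero (fun s ↦ (hk s).differentiableAt) (fun s ↦ (hk s).deriv) t 0
  have h1 := hconst (k := fun s ↦ f s * Real.cosh s - g s * Real.sinh s) fun s ↦ by
    convert! ((hf s).mul (Real.hasDerivAt_cosh s)).sub ((hg s).mul (Real.hasDerivAt_sinh s))
      using 1
    ring
  have h2 := hconst (k := fun s ↦ f s * Real.sinh s - g s * Real.cosh s) fun s ↦ by
    convert! ((hf s).mul (Real.hasDerivAt_sinh s)).sub ((hg s).mul (Real.hasDerivAt_cosh s))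
      using 1
    ring
  simp only [Real.cosh_zero, Real.sinh_zero, h0] at h1 h2
  linear_combination Real.cosh t * h1 - Real.sinh t * h2 - f t * Real.cosh_sq t

theorem abs_arctan_le_abs (x : ℝ) : |Real.arctan x| ≤ |x| := by
  wlog hx : 0 ≤ x generalizing x
  · simpa using this (-x) (by linarith)
  have h0 := Real.arctan_nonneg.mpr hx
  rw [abs_of_nonneg hx, abs_of_nonneg h0]
  simpa using Real.le_tan h0 (Real.arctan_lt_pi_div_two x)

theorem abs_arctan_div_self_le_one (x : ℝ) : |Real.arctan x / x| ≤ 1 := by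
  rw [abs_div]
  exact div_le_one_of_le₀ (abs_arctan_le_abs x) (abs_nonneg x)

/-- `Ti₂(e^t) - t arctan(e^t)`, where `Ti₂` is the inverse tangent integral. -/
noncomputable def tiExp (t : ℝ) : ℝ :=
  (∫ v in (0 : ℝ)..Real.exp t, Real.arctan v / v) - t * Real.arctan (Real.exp t)

theorem hasDerivAt_tiExp (t : ℝ) : HasDerivAt tiExp (-(t / (2 * Real.cosh t))) t := by
  have hm : Measurable fun v : ℝ ↦ Real.arctan v / v := by fun_prop
  have hi : IntervalIntegrable (fun v : ℝ ↦ Real.arctan v / v) volume 0 (Real.exp t) :=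
    (intervalIntegrable_const (c := (1 : ℝ))).mono_fun hm.aestronglyMeasurable
      (ae_of_all _ fun v ↦ by simpa [abs_div] using abs_arctan_div_self_le_one v)
  have hc : ContinuousAt (fun v : ℝ ↦ Real.arctan v / v) (Real.exp t) :=
    Real.continuous_arctan.continuousAt.div continuousAt_id (Real.exp_pos t).ne'
  have h1 := (intervalIntegral.integral_hasDerivAt_right hi
    hm.stronglyMeasurable.stronglyMeasurableAtFilter hc).comp t (Real.hasDerivAt_exp t)
  have h2 := (hasDerivAt_id t).mul (Real.hasDerivAt_exp t).arctan
  convert! h1.sub h2 using 1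
  have he := Real.exp_pos t
  rw [Real.cosh_eq, Real.exp_neg]
  simp only [id]
  field_simp
  ring

theorem abs_tiExp_neg_le {s : ℝ} (hs : 0 ≤ s) : |tiExp (-s)| ≤ (1 + s) * Real.exp (-s) := by
  have h1 := intervalIntegral.norm_integral_le_of_norm_le_const (a := 0) (b := Real.exp (-s))
    (f := fun v ↦ Real.arctan v / v) (C := 1) fun v _ ↦ abs_arctan_div_self_le_one v
  have h2 := abs_arctan_le_abs (Real.exp (-s))
  rw [Real.abs_exp] at h2
  rw [sub_zero, Real.abs_exp, one_mul, Real.norm_eq_abs] at h1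
  have h3 : |s * Real.arctan (Real.exp (-s))| ≤ s * Real.exp (-s) := by
    rw [abs_mul, abs_of_nonneg hs]
    gcongr
  rw [tiExp, neg_mul, sub_neg_eq_add]
  linarith [abs_add_le (∫ v in (0 : ℝ)..Real.exp (-s), Real.arctan v / v)
    (s * Real.arctan (Real.exp (-s)))]

theorem coshPotential_eq_tiExp (t : ℝ) :
    coshPotential t = 2 * Real.cosh t * tiExp t - 1 := by
  set D : ℝ → ℝ := fun t ↦ coshPotential t - (2 * Real.cosh t * tiExp t - 1) with hD
  set E : ℝ → ℝ := fun t ↦ coshTransformPrimitive t - (2 * Real.sinh t * tiExp t - t) with hE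
  have hDE (s : ℝ) : HasDerivAt D (E s) s := by
    have h := (((Real.hasDerivAt_cosh s).const_mul 2).mul (hasDerivAt_tiExp s)).sub_const 1
    convert! (hasDerivAt_coshPotential s).sub h using 1
    have := (Real.cosh_pos s).ne'
    simp only [hE]
    field_simp
    ring
  have hED (s : ℝ) : HasDerivAt E (D s) s := by
    have h := (((Real.hasDerivAt_sinh s).const_mul 2).mul (hasDerivAt_tiExp s)).sub
      (hasDerivAt_id s)
    convert! (hasDerivAt_coshTransformPrimitive s).sub h using 1
    have := (Real.cosh_pos s).ne'
    simp only [hD, coshPotential_eq, Real.tanh_eq_sinh_div_cosh]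
    field_simp
    ring
  have hE0 : E 0 = 0 := by simp [hE, coshTransformPrimitive]
  have hsol := eq_mul_cosh_of_hasDerivAt hDE hED hE0
  set M := ∫ x in Ioi (0 : ℝ), coshWeight x
  have hbound {s : ℝ} (hs : 0 ≤ s) : |D 0| ≤ 2 * (M + 2 * (1 + s)) * Real.exp (-s) := by
    have hcosh := Real.cosh_pos s
    have h1 : coshTransform (-s) + s * Real.tanh s + 1 - 2 * Real.cosh s * tiExp (-s) =
        D 0 * Real.cosh s := by
      have := hsol (-s)
      simp only [hD, coshPotential_eq (-s), Real.tanh_neg, Real.cosh_neg] at this ⊢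
      linear_combination this
    have h2 := abs_coshTransform_le (-s)
    have h3 := abs_tiExp_neg_le hs
    have h4 : |Real.tanh s| ≤ 1 := (Real.abs_tanh_lt_one s).le
    have h5 : 1 ≤ 2 * Real.exp (-s) * Real.cosh s := by
      rw [Real.cosh_eq, Real.exp_neg]
      have := Real.exp_pos s
      field_simp
      nlinarith
    have hM : 0 ≤ M := (abs_nonneg _).trans h2
    have h6 : |D 0| * Real.cosh s ≤ M + (1 + s) + 2 * Real.cosh s * ((1 + s) * Real.exp (-s)) := by
      rw [← abs_of_pos hcosh, ← abs_mul, ← h1, abs_of_pos hcosh]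
      have h7 : |s * Real.tanh s| ≤ s := by
        rw [abs_mul, abs_of_nonneg hs]
        exact mul_le_of_le_one_right hs h4
      have h8 : |2 * Real.cosh s * tiExp (-s)| ≤
          2 * Real.cosh s * ((1 + s) * Real.exp (-s)) := by
        rw [abs_mul, abs_of_pos (by positivity : 0 < 2 * Real.cosh s)]
        gcongr
      rw [abs_le] at *
      constructor <;> linarith
    have h9 : M + (1 + s) ≤ (M + (1 + s)) * (2 * Real.exp (-s) * Real.cosh s) :=
      le_mul_of_one_le_right (by positivity) h5
    refine le_of_mul_le_mul_right (h6.trans ?_) hcosh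
    linarith
  have hlim : Tendsto (fun s : ℝ ↦ 2 * (M + 2 * (1 + s)) * Real.exp (-s)) atTop (𝓝 0) := by
    have h0 := Real.tendsto_exp_neg_atTop_nhds_zero.const_mul (2 * M + 4)
    have h1 := (Real.tendsto_pow_mul_exp_neg_atTop_nhds_zero 1).const_mul 4
    convert! h0.add h1 using 1
    · ext s
      ring
    · simp
  have hD0 : D 0 = 0 := abs_nonpos_iff.mp <| ge_of_tendsto hlim <|
    (eventually_ge_atTop 0).mono fun s hs ↦ hbound hs
  have := hsol t
  rw [hD0, zero_mul] at this
  exact sub_eq_zero.mp this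

/-- `coshTransform` as an explicit integral. -/
theorem explicit_integral_eq_coshTransform (t : ℝ) :
    Real.pi / 2 * ∫ x in Ioi (0 : ℝ),
        Real.cos (t * x) * x ^ 2 * Real.cosh (Real.pi * x / 2) /
          ((1 + x ^ 2) * Real.sinh (Real.pi * x / 2) ^ 2) = coshTransform t := by
  rw [coshTransform, ← integral_const_mul]
  refine integral_congr_ae (ae_of_all _ fun x ↦ ?_)
  simp only [coshWeight, coshKernel]
  field_simp

end CoshTransform

/-- For every `t ≥ 0`,
`(π/2)∫_0^∞ cos(tx) x² cosh(πx/2)/((1+x²) sinh²(πx/2)) dx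
  = -1 - t tanh(t) + 2 cosh(t)(Ti₂(e^t) - t arctan(e^t))`,
where `Ti₂(u) = ∫_0^u arctan(v)/v dv` is the inverse tangent integral. -/
theorem cosineTransform_bdcf_cosh_khintchine (t : ℝ) (ht : 0 ≤ t) :
    Real.pi / 2 * ∫ x in Set.Ioi (0 : ℝ),
        Real.cos (t * x) * x ^ 2 * Real.cosh (Real.pi * x / 2) /
          ((1 + x ^ 2) * Real.sinh (Real.pi * x / 2) ^ 2) =
      -1 - t * Real.tanh t + 2 * Real.cosh t *
        ((∫ v in (0 : ℝ)..Real.exp t, Real.arctan v / v) - t * Real.arctan (Real.exp t)) := by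
  have h := CoshTransform.coshPotential_eq t
  rw [CoshTransform.coshPotential_eq_tiExp, CoshTransform.tiExp] at h
  rw [CoshTransform.explicit_integral_eq_coshTransform]
  linear_combination -h
end

section
/- (π/2)·∫_0^∞ x²·cosh(πx/2) / ((1 + x²)·sinh²(πx/2)) dx = 2·C - 1, where C = Σ_{n=0}^∞ (-1)^n/(2n+1)² is Catalan's constant. -/
open Real Set Filter Topology MeasureTheory

theorem HasSum.of_eq {ι α : Type*} [AddCommMonoid α] [TopologicalSpace α] {f g : ι → α} {a b : α}
    (h : HasSum f a) (hfg : ∀ n, g n = f n) (hab : b = a) : HasSum g b := by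
  rwa [hab, funext hfg]

theorem hasSum_pi_mul_coth {y : ℝ} (hy : 0 < y) :
    HasSum (fun n : ℕ => 2 * y / (y ^ 2 + ((n : ℝ) + 1) ^ 2))
      (π * (cosh (π * y) / sinh (π * y)) - 1 / y) := by
  have hz : (y * Complex.I : ℂ) ∈ Complex.integerComplement := by
    rintro ⟨k, hk⟩
    have := congrArg Complex.im hk
    simp at this
    exact hy.ne this
  have hs := summable_cotTerm hz
  have h := (hs.hasSum_iff_tendsto_nat.2 (tendsto_logDeriv_euler_cot_sub hz)).mul_left Complex.I
  rw [← Complex.hasSum_ofReal]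
  refine h.of_eq (fun n => ?_) ?_
  · rw [cotTerm_identity hz]
    have h1 : ((y : ℂ) * Complex.I + (n + 1)) * (y * Complex.I - (n + 1))
        = -((y ^ 2 + ((n : ℝ) + 1) ^ 2 : ℝ) : ℂ) := by
      push_cast
      linear_combination (y : ℂ) ^ 2 * Complex.I_sq
    rw [h1]
    push_cast
    rw [one_div, inv_neg, div_eq_mul_inv]
    linear_combination 2 * y * ((y : ℂ) ^ 2 + ((n : ℂ) + 1) ^ 2)⁻¹ * Complex.I_sq
  · have hy' : (y : ℂ) ≠ 0 := by exact_mod_cast hy.ne'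
    have hs0 : Complex.sinh (π * y) ≠ 0 := by
      rw [← Complex.ofReal_mul, ← Complex.ofReal_sinh]
      exact_mod_cast (sinh_pos_iff.2 (by positivity)).ne'
    rw [Complex.cot, ← mul_assoc, Complex.cos_mul_I, Complex.sin_mul_I]
    push_cast
    have := Complex.I_ne_zero
    field_simp

theorem one_div_sinh_two_mul {u : ℝ} (hu : 0 < u) :
    1 / sinh (2 * u) = cosh u / sinh u - cosh (2 * u) / sinh (2 * u) := by
  have hs := (sinh_pos_iff.2 hu).ne'
  have hc := (cosh_pos u).ne'
  rw [cosh_two_mul, sinh_two_mul]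
  field_simp
  linear_combination -cosh_sq u

theorem hasSum_pi_div_sinh {y : ℝ} (hy : 0 < y) :
    HasSum (fun n : ℕ => (-1) ^ (n + 1) * (2 * y / (y ^ 2 + ((n : ℝ) + 1) ^ 2)))
      (π / sinh (π * y) - 1 / y) := by
  have hS := hasSum_pi_mul_coth hy
  obtain ⟨E, hE⟩ : Summable fun k : ℕ => 2 * y / (y ^ 2 + (((2 * k : ℕ) : ℝ) + 1) ^ 2) :=
    hS.summable.comp_injective (mul_right_injective₀ (two_ne_zero' ℕ))
  have hO : HasSum (fun k : ℕ => 2 * y / (y ^ 2 + (((2 * k + 1 : ℕ) : ℝ) + 1) ^ 2))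
      (1 / 2 * (π * (cosh (π * (y / 2)) / sinh (π * (y / 2))) - 1 / (y / 2))) := by
    refine ((hasSum_pi_mul_coth (half_pos hy)).mul_left (1 / 2)).of_eq (fun k => ?_) rfl
    rw [show y ^ 2 + (((2 * k + 1 : ℕ) : ℝ) + 1) ^ 2 = 4 * ((y / 2) ^ 2 + ((k : ℝ) + 1) ^ 2) by
      push_cast; ring]
    have h2 : ((y / 2) ^ 2 + ((k : ℝ) + 1) ^ 2) ≠ 0 := by positivity
    generalize (y / 2) ^ 2 + ((k : ℝ) + 1) ^ 2 = d at h2 ⊢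
    field_simp
    norm_num
  have hT := (HasSum.even_add_odd (f := fun n : ℕ => 2 * y / (y ^ 2 + ((n : ℝ) + 1) ^ 2))
    hE hO).unique hS
  refine (HasSum.even_add_odd
    (f := fun n : ℕ => (-1) ^ (n + 1) * (2 * y / (y ^ 2 + ((n : ℝ) + 1) ^ 2)))
    (hE.neg.of_eq (fun k => ?_) rfl) (hO.of_eq (fun k => ?_) rfl)).of_eq (fun _ => rfl) ?_
  · rw [pow_succ, pow_mul, neg_one_sq, one_pow, one_mul, neg_one_mul]
  · rw [pow_succ, pow_succ, pow_mul, neg_one_sq, one_pow]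
    ring
  · have key := one_div_sinh_two_mul (by positivity : 0 < π * (y / 2))
    rw [show 2 * (π * (y / 2)) = π * y by ring] at key
    linear_combination π * key + hT

theorem hasDerivAt_half_arctan_add (x : ℝ) :
    HasDerivAt (fun x : ℝ => (x / (1 + x ^ 2) + arctan x) / 2) (1 / (1 + x ^ 2) ^ 2) x := by
  have h0 : 1 + x ^ 2 ≠ 0 := by positivity
  refine ((((hasDerivAt_id' x).fun_div (((hasDerivAt_id' x).fun_pow 2).const_add 1) h0).fun_add
    (hasDerivAt_arctan x)).div_const 2).congr_deriv ?_
  field_simp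
  ring

theorem tendsto_div_one_add_sq_atTop :
    Tendsto (fun x : ℝ => x / (1 + x ^ 2)) atTop (𝓝 0) := by
  refine tendsto_of_tendsto_of_tendsto_of_le_of_le' tendsto_const_nhds tendsto_inv_atTop_zero
    ?_ ?_
  · filter_upwards [eventually_ge_atTop 0] with x hx using by positivity
  · filter_upwards [eventually_gt_atTop 0] with x hx
    rw [div_le_iff₀ (by positivity)]
    field_simp
    linarith

theorem tendsto_half_arctan_add :
    Tendsto (fun x : ℝ => (x / (1 + x ^ 2) + arctan x) / 2) atTop (𝓝 (π / 4)) := by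
  convert (tendsto_div_one_add_sq_atTop.add
    (tendsto_arctan_atTop.mono_right nhdsWithin_le_nhds)).div_const 2 using 2
  ring

theorem integrableOn_one_div_one_add_sq_sq :
    IntegrableOn (fun x : ℝ => 1 / (1 + x ^ 2) ^ 2) (Ioi 0) :=
  integrableOn_Ioi_deriv_of_nonneg' (fun x _ => hasDerivAt_half_arctan_add x)
    (fun x _ => by positivity) tendsto_half_arctan_add

theorem integral_one_div_one_add_sq_sq :
    ∫ x in Ioi (0 : ℝ), 1 / (1 + x ^ 2) ^ 2 = π / 4 := by
  rw [integral_Ioi_of_hasDerivAt_of_nonneg' (fun x _ => hasDerivAt_half_arctan_add x)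
    (fun x _ => by positivity) tendsto_half_arctan_add]
  simp

theorem integral_sq_div_one_add_sq_sq_mul {a : ℝ} (ha : 1 < a) :
    IntegrableOn (fun x : ℝ => x ^ 2 / ((1 + x ^ 2) ^ 2 * (x ^ 2 + a ^ 2))) (Ioi 0) ∧
    ∫ x in Ioi (0 : ℝ), x ^ 2 / ((1 + x ^ 2) ^ 2 * (x ^ 2 + a ^ 2)) = π / (4 * (a + 1) ^ 2) := by
  have ha0 : a ≠ 0 := by positivity
  have ha1 : a ^ 2 - 1 ≠ 0 := by nlinarith
  have ha2 : a + 1 ≠ 0 := by positivity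
  let F : ℝ → ℝ := fun x => a ^ 2 / (a ^ 2 - 1) ^ 2 * arctan x
    - 1 / (a ^ 2 - 1) * ((x / (1 + x ^ 2) + arctan x) / 2)
    - a / (a ^ 2 - 1) ^ 2 * arctan (x / a)
  have hd : ∀ x ∈ Ici (0 : ℝ),
      HasDerivAt F (x ^ 2 / ((1 + x ^ 2) ^ 2 * (x ^ 2 + a ^ 2))) x := by
    intro x _
    have h0 : 1 + x ^ 2 ≠ 0 := by positivity
    have h1 : x ^ 2 + a ^ 2 ≠ 0 := by positivity
    have h2 : 1 + (x / a) ^ 2 ≠ 0 := by positivity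
    refine ((((hasDerivAt_arctan x).const_mul (a ^ 2 / (a ^ 2 - 1) ^ 2)).fun_sub
      ((hasDerivAt_half_arctan_add x).const_mul (1 / (a ^ 2 - 1)))).fun_sub
      ((((hasDerivAt_id' x).div_const a).arctan).const_mul (a / (a ^ 2 - 1) ^ 2))).congr_deriv ?_
    have h3 : 1 / (1 + (x / a) ^ 2) = a ^ 2 / (x ^ 2 + a ^ 2) := by
      field_simp
      ring
    rw [h3]
    field_simp
    ring
  have hp : ∀ x ∈ Ioi (0 : ℝ), 0 ≤ x ^ 2 / ((1 + x ^ 2) ^ 2 * (x ^ 2 + a ^ 2)) :=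
    fun x _ => by positivity
  have hat := tendsto_arctan_atTop.mono_right nhdsWithin_le_nhds
  have hl : Tendsto F atTop (𝓝 (π / (4 * (a + 1) ^ 2))) := by
    have hlim : π / (4 * (a + 1) ^ 2) = a ^ 2 / (a ^ 2 - 1) ^ 2 * (π / 2)
        - 1 / (a ^ 2 - 1) * (π / 4) - a / (a ^ 2 - 1) ^ 2 * (π / 2) := by
      field_simp
      ring
    rw [hlim]
    exact ((hat.const_mul (a ^ 2 / (a ^ 2 - 1) ^ 2)).sub
      (tendsto_half_arctan_add.const_mul (1 / (a ^ 2 - 1)))).sub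
      ((hat.comp (tendsto_id.atTop_div_const (by positivity : 0 < a))).const_mul
        (a / (a ^ 2 - 1) ^ 2))
  refine ⟨integrableOn_Ioi_deriv_of_nonneg' hd hp hl, ?_⟩
  rw [integral_Ioi_of_hasDerivAt_of_nonneg' hd hp hl]
  simp [F]

theorem summable_one_div_odd_sq : Summable fun n : ℕ => 1 / (2 * (n : ℝ) + 1) ^ 2 := by
  simpa [Function.comp_def] using (Real.summable_one_div_nat_pow.2 one_lt_two).comp_injective
    (fun a b h => by simpa using h : Function.Injective fun n : ℕ => 2 * n + 1)

theorem le_sinh_pi_mul_div_two {x : ℝ} (hx : 0 ≤ x) : x ≤ sinh (π * x / 2) := by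
  refine le_trans ?_ (self_le_sinh_iff.2 (by positivity))
  nlinarith [pi_gt_three]

theorem integrableOn_two_mul_div_one_add_sq_sq_mul_sinh :
    IntegrableOn (fun x : ℝ => 2 * x / ((1 + x ^ 2) ^ 2 * sinh (π * x / 2))) (Ioi 0) := by
  refine (integrableOn_one_div_one_add_sq_sq.const_mul 2).mono'
    (Measurable.aestronglyMeasurable (by fun_prop)) ?_
  filter_upwards [ae_restrict_mem measurableSet_Ioi] with x hx
  have hx : 0 < x := hx
  have hs := le_sinh_pi_mul_div_two hx.le
  have hs0 := hx.trans_le hs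
  rw [norm_of_nonneg (by positivity), mul_one_div, div_le_div_iff₀ (by positivity) (by positivity)]
  have : 0 ≤ 2 * (1 + x ^ 2) ^ 2 := by positivity
  nlinarith [mul_le_mul_of_nonneg_left hs this]

theorem hasSum_two_mul_div_one_add_sq_sq_mul_sinh {x : ℝ} (hx : 0 < x) :
    HasSum (fun n : ℕ => (-1) ^ (n + 1) * (8 / π) *
        (x ^ 2 / ((1 + x ^ 2) ^ 2 * (x ^ 2 + (2 * (n : ℝ) + 2) ^ 2))))
      (2 * x / ((1 + x ^ 2) ^ 2 * sinh (π * x / 2)) - 4 / π * (1 / (1 + x ^ 2) ^ 2)) := by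
  have hs := (hx.trans_le (le_sinh_pi_mul_div_two hx.le)).ne'
  refine ((hasSum_pi_div_sinh (half_pos hx)).mul_left (2 * x / (π * (1 + x ^ 2) ^ 2))).of_eq
    (fun n => ?_) ?_
  · rw [show (x / 2) ^ 2 + ((n : ℝ) + 1) ^ 2 = (x ^ 2 + (2 * (n : ℝ) + 2) ^ 2) / 4 by ring]
    field_simp
    ring
  · rw [← mul_div_assoc]
    field_simp
    ring

theorem integral_two_mul_div_one_add_sq_sq_mul_sinh :
    ∫ x in Ioi (0 : ℝ), 2 * x / ((1 + x ^ 2) ^ 2 * sinh (π * x / 2)) =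
      2 * (∑' n : ℕ, (-1) ^ n / (2 * (n : ℝ) + 1) ^ 2) - 1 := by
  have hI (n : ℕ) := integral_sq_div_one_add_sq_sq_mul
    (by linarith [n.cast_nonneg (α := ℝ)] : 1 < 2 * (n : ℝ) + 2)
  have hnorm (n : ℕ) : ∫ x in Ioi (0 : ℝ), ‖(-1) ^ (n + 1) * (8 / π) *
      (x ^ 2 / ((1 + x ^ 2) ^ 2 * (x ^ 2 + (2 * (n : ℝ) + 2) ^ 2)))‖ =
      2 * (1 / (2 * ((n + 1 : ℕ) : ℝ) + 1) ^ 2) := by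
    have (x : ℝ) : ‖(-1) ^ (n + 1) * (8 / π) *
        (x ^ 2 / ((1 + x ^ 2) ^ 2 * (x ^ 2 + (2 * (n : ℝ) + 2) ^ 2)))‖ = (8 / π) *
        (x ^ 2 / ((1 + x ^ 2) ^ 2 * (x ^ 2 + (2 * (n : ℝ) + 2) ^ 2))) := by
      simp only [norm_mul, norm_pow, norm_neg, norm_one, one_pow, one_mul]
      rw [norm_of_nonneg (by positivity), norm_of_nonneg (by positivity)]
    simp_rw [this]
    rw [integral_const_mul, (hI n).2, show 2 * (n : ℝ) + 2 + 1 = 2 * (n : ℝ) + 3 by ring,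
      show 2 * ((n + 1 : ℕ) : ℝ) + 1 = 2 * (n : ℝ) + 3 by push_cast; ring]
    field_simp
    norm_num
  have hint (n : ℕ) : ∫ x in Ioi (0 : ℝ), (-1) ^ (n + 1) * (8 / π) *
      (x ^ 2 / ((1 + x ^ 2) ^ 2 * (x ^ 2 + (2 * (n : ℝ) + 2) ^ 2))) =
      2 * ((-1) ^ (n + 1) / (2 * ((n + 1 : ℕ) : ℝ) + 1) ^ 2) := by
    rw [integral_const_mul, (hI n).2, show 2 * (n : ℝ) + 2 + 1 = 2 * (n : ℝ) + 3 by ring,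
      show 2 * ((n + 1 : ℕ) : ℝ) + 1 = 2 * (n : ℝ) + 3 by push_cast; ring]
    field_simp
    norm_num
  have hmain := (hasSum_integral_of_summable_integral_norm
    (fun n => (hI n).1.const_mul ((-1) ^ (n + 1) * (8 / π)))
    (by
      simp_rw [hnorm]
      exact ((summable_nat_add_iff 1).2 summable_one_div_odd_sq).mul_left 2)).tsum_eq
  simp_rw [hint] at hmain
  rw [tsum_mul_left, setIntegral_congr_fun measurableSet_Ioi
    (fun x hx => (hasSum_two_mul_div_one_add_sq_sq_mul_sinh hx).tsum_eq),
    integral_sub integrableOn_two_mul_div_one_add_sq_sq_mul_sinh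
      (integrableOn_one_div_one_add_sq_sq.const_mul _), integral_const_mul,
    integral_one_div_one_add_sq_sq] at hmain
  have hsum : Summable fun n : ℕ => (-1 : ℝ) ^ n / (2 * (n : ℝ) + 1) ^ 2 :=
    summable_one_div_odd_sq.of_norm_bounded fun n => by simp
  rw [hsum.tsum_eq_zero_add]
  have hpi : 4 / π * (π / 4) = 1 := by field_simp
  rw [hpi] at hmain
  simp only [pow_zero, Nat.cast_zero, mul_zero, zero_add, one_pow, div_one]
  linarith

theorem cosh_mul_sq_le_two_mul_sinh_sq {y : ℝ} (hy : 0 ≤ y) :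
    y ^ 2 * cosh y ≤ 2 * sinh y ^ 2 := by
  obtain ⟨u, rfl⟩ : ∃ u, y = 2 * u := ⟨y / 2, by ring⟩
  have hu : 0 ≤ u := by linarith
  have h1 : u ^ 2 ≤ sinh u ^ 2 := by gcongr; exact self_le_sinh_iff.2 hu
  have h2 : cosh (2 * u) ≤ 2 * cosh u ^ 2 := by
    rw [cosh_two_mul]
    linarith [cosh_sq u]
  calc (2 * u) ^ 2 * cosh (2 * u) = 4 * (u ^ 2 * cosh (2 * u)) := by ring
    _ ≤ 4 * (sinh u ^ 2 * (2 * cosh u ^ 2)) := by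
      have := (cosh_pos (2 * u)).le
      gcongr
    _ = 2 * sinh (2 * u) ^ 2 := by
      rw [sinh_two_mul]
      ring

theorem integrableOn_sq_mul_cosh_div_one_add_sq_mul_sinh_sq :
    IntegrableOn (fun x : ℝ => x ^ 2 * cosh (π * x / 2) /
      ((1 + x ^ 2) * sinh (π * x / 2) ^ 2)) (Ioi 0) := by
  refine (integrable_inv_one_add_sq.integrableOn.const_mul 2).mono'
    (Measurable.aestronglyMeasurable (by fun_prop)) ?_
  filter_upwards [ae_restrict_mem measurableSet_Ioi] with x hx
  have hx : 0 < x := hx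
  have hs0 := hx.trans_le (le_sinh_pi_mul_div_two hx.le)
  have hc := cosh_pos (π * x / 2)
  have h1 := cosh_mul_sq_le_two_mul_sinh_sq (by positivity : 0 ≤ π * x / 2)
  have h2 : x ^ 2 ≤ (π * x / 2) ^ 2 := by
    gcongr
    nlinarith [pi_gt_three]
  have h3 := mul_le_mul_of_nonneg_right h2 hc.le
  rw [norm_of_nonneg (by positivity), ← div_eq_mul_inv,
    div_le_div_iff₀ (by positivity) (by positivity)]
  have : 0 ≤ 1 + x ^ 2 := by positivity
  nlinarith [mul_le_mul_of_nonneg_left (h3.trans h1) this]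

theorem integral_deriv_sq_div_one_add_sq_mul_sinh :
    ∫ x in Ioi (0 : ℝ), (2 * x / ((1 + x ^ 2) ^ 2 * sinh (π * x / 2)) -
      π / 2 * (x ^ 2 * cosh (π * x / 2) / ((1 + x ^ 2) * sinh (π * x / 2) ^ 2))) = 0 := by
  have hbd {x : ℝ} (hx : 0 < x) : 0 ≤ x ^ 2 / ((1 + x ^ 2) * sinh (π * x / 2)) ∧
      x ^ 2 / ((1 + x ^ 2) * sinh (π * x / 2)) ≤ x / (1 + x ^ 2) := by
    have hs := le_sinh_pi_mul_div_two hx.le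
    have hs0 := hx.trans_le hs
    refine ⟨by positivity, ?_⟩
    rw [div_le_div_iff₀ (by positivity) (by positivity)]
    have : 0 ≤ x * (1 + x ^ 2) := by positivity
    nlinarith [mul_le_mul_of_nonneg_left hs this]
  rw [integral_Ioi_of_hasDerivAt_of_tendsto
    (f := fun x => x ^ 2 / ((1 + x ^ 2) * sinh (π * x / 2))) (m := 0)]
  · simp
  · rw [← continuousWithinAt_Ioi_iff_Ici, ContinuousWithinAt]
    have h0 : Tendsto (fun x : ℝ => x / (1 + x ^ 2)) (𝓝[>] 0) (𝓝 0) := by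
      have : ContinuousAt (fun x : ℝ => x / (1 + x ^ 2)) 0 :=
        continuousAt_id.div (by fun_prop) (by simp)
      simpa [ContinuousAt] using this.tendsto.mono_left nhdsWithin_le_nhds
    simp only [ne_eq, OfNat.ofNat_ne_zero, not_false_eq_true, zero_pow, zero_div]
    refine tendsto_of_tendsto_of_tendsto_of_le_of_le' tendsto_const_nhds h0 ?_ ?_
    · filter_upwards [self_mem_nhdsWithin] with x hx using (hbd hx).1
    · filter_upwards [self_mem_nhdsWithin] with x hx using (hbd hx).2
  · intro x hx
    have hx : 0 < x := hx
    have hs0 := (hx.trans_le (le_sinh_pi_mul_div_two hx.le)).ne'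
    have h0 : 1 + x ^ 2 ≠ 0 := by positivity
    refine (((hasDerivAt_id' x).fun_pow 2).fun_div
      ((((hasDerivAt_id' x).fun_pow 2).const_add 1).fun_mul
      (((hasDerivAt_id' x).const_mul π).div_const 2).sinh) (mul_ne_zero h0 hs0)).congr_deriv ?_
    field_simp
    ring
  · exact integrableOn_two_mul_div_one_add_sq_sq_mul_sinh.sub
      (integrableOn_sq_mul_cosh_div_one_add_sq_mul_sinh_sq.const_mul _)
  · refine tendsto_of_tendsto_of_tendsto_of_le_of_le' tendsto_const_nhds
      tendsto_div_one_add_sq_atTop ?_ ?_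
    · filter_upwards [eventually_gt_atTop 0] with x hx using (hbd hx).1
    · filter_upwards [eventually_gt_atTop 0] with x hx using (hbd hx).2

/-- `(π/2)∫_0^∞ x² cosh(πx/2)/((1+x²) sinh²(πx/2)) dx = 2C - 1`, where
`C = Σ_{n=0}^∞ (-1)^n/(2n+1)²` is Catalan's constant. -/
theorem integral_bdcf_cosh_total_mass :
    Real.pi / 2 * ∫ x in Set.Ioi (0 : ℝ),
        x ^ 2 * Real.cosh (Real.pi * x / 2) /
          ((1 + x ^ 2) * Real.sinh (Real.pi * x / 2) ^ 2) =
      2 * (∑' n : ℕ, (-1) ^ n / (2 * (n : ℝ) + 1) ^ 2) - 1 := by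
  have h := integral_deriv_sq_div_one_add_sq_mul_sinh
  rw [integral_sub integrableOn_two_mul_div_one_add_sq_sq_mul_sinh
    (integrableOn_sq_mul_cosh_div_one_add_sq_mul_sinh_sq.const_mul _), integral_const_mul,
    integral_two_mul_div_one_add_sq_sq_mul_sinh] at h
  linarith
end

section
/- For every real x > 0, ∫_0^x sinh(x - u) · u·(1 - e^{2u})/sinh(2u) du = -1 + x + e^{-x} - 2·C·cosh(x) + 2·cosh(x)·( ∫_0^{e^x} arctan(v)/v dv - x·arctan(e^x) ), where C = Σ_{n=0}^∞ (-1)^n/(2n+1)² is Catalan's constant. -/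
open MeasureTheory in
theorem intervalIntegrable_arctan_div_self (a b : ℝ) :
    IntervalIntegrable (fun v => Real.arctan v / v) volume a b := by
  have hc : Continuous (dslope Real.arctan 0) := by
    rw [← continuousOn_univ, continuousOn_dslope Filter.univ_mem]
    exact ⟨Real.continuous_arctan.continuousOn, Real.differentiableAt_arctan 0⟩
  refine (hc.intervalIntegrable a b).congr_ae (ae_restrict_of_ae ?_)
  filter_upwards [compl_mem_ae_iff.mpr (measure_singleton (0 : ℝ))] with v hv
  rw [dslope_of_ne _ hv, slope_def_field, Real.arctan_zero, sub_zero, sub_zero]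

theorem hasDerivAt_integral_arctan_div_self {y : ℝ} (hy : 0 < y) :
    HasDerivAt (fun z => ∫ v in (0 : ℝ)..z, Real.arctan v / v) (Real.arctan y / y) y := by
  refine intervalIntegral.integral_hasDerivAt_right (intervalIntegrable_arctan_div_self 0 y)
    ?_ (Real.continuous_arctan.continuousAt.div continuousAt_id hy.ne')
  exact (Real.measurable_arctan.div measurable_id).stronglyMeasurable.stronglyMeasurableAtFilter

open MeasureTheory Set in
/-- The inverse tangent integral at `1` is Catalan's constant. -/
theorem integral_arctan_div_self_zero_one :
    ∫ v in (0 : ℝ)..1, Real.arctan v / v = ∑' n : ℕ, (-1) ^ n / (2 * (n : ℝ) + 1) ^ 2 := by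
  have hpow (c : ℝ) (n : ℕ) :
      ∫ v in Ioo (0 : ℝ) 1, c * v ^ (2 * n) / (2 * (n : ℝ) + 1) = c / (2 * (n : ℝ) + 1) ^ 2 := by
    rw [← integral_Ioc_eq_integral_Ioo, ← intervalIntegral.integral_of_le zero_le_one,
      intervalIntegral.integral_div, intervalIntegral.integral_const_mul, integral_pow]
    have : 2 * (n : ℝ) + 1 ≠ 0 := by positivity
    push_cast
    field_simp
    simp
  have hint (n : ℕ) : Integrable (fun v : ℝ => (-1) ^ n * v ^ (2 * n) / (2 * (n : ℝ) + 1))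
      (volume.restrict (Ioo 0 1)) := by
    refine (Continuous.integrableOn_Icc ?_).mono_set Ioo_subset_Icc_self
    fun_prop
  have hnorm (n : ℕ) : ∫ v in Ioo (0 : ℝ) 1, ‖(-1) ^ n * v ^ (2 * n) / (2 * (n : ℝ) + 1)‖ =
      1 / (2 * (n : ℝ) + 1) ^ 2 := by
    rw [← hpow]
    refine setIntegral_congr_fun measurableSet_Ioo fun v hv => ?_
    have : 0 < v := hv.1
    have h : 0 ≤ v ^ (2 * n) / (2 * (n : ℝ) + 1) := by positivity
    simp only [mul_div_assoc, norm_mul, norm_pow, norm_neg, norm_one, one_pow,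
      Real.norm_of_nonneg h]
  have hsum : Summable fun n : ℕ => ∫ v in Ioo (0 : ℝ) 1,
      ‖(-1) ^ n * v ^ (2 * n) / (2 * (n : ℝ) + 1)‖ := by
    simp only [hnorm]
    have h := (summable_nat_add_iff 1).mpr (Real.summable_one_div_nat_pow.mpr one_lt_two)
    refine h.of_nonneg_of_le (fun n => by positivity) fun n => ?_
    push_cast
    gcongr
    linarith [(Nat.cast_nonneg n : (0 : ℝ) ≤ n)]
  have key := (hasSum_integral_of_summable_integral_norm hint hsum).tsum_eq
  simp only [hpow] at key
  rw [key, intervalIntegral.integral_of_le zero_le_one, integral_Ioc_eq_integral_Ioo]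
  refine setIntegral_congr_fun measurableSet_Ioo fun v hv => ?_
  have hv0 : v ≠ 0 := hv.1.ne'
  have h := (Real.hasSum_arctan (x := v)
    (by rw [Real.norm_of_nonneg hv.1.le]; exact hv.2)).div_const v
  refine (h.tsum_eq.symm.trans (tsum_congr fun n => ?_))
  have : 2 * (n : ℝ) + 1 ≠ 0 := by positivity
  push_cast
  field_simp
  ring

theorem sinh_sub_mul_bdcf_kernel (x u : ℝ) :
    Real.sinh (x - u) * (u * (1 - Real.exp (2 * u)) / Real.sinh (2 * u)) =
      Real.exp (-x) * (u * Real.exp u) - Real.cosh x * (u / Real.cosh u) := by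
  rcases eq_or_ne u 0 with rfl | hu
  · simp
  have hs : Real.sinh u ≠ 0 := by simpa using hu
  have hc : Real.cosh u ≠ 0 := (Real.cosh_pos u).ne'
  have hexp : 1 - Real.exp (2 * u) = -2 * Real.exp u * Real.sinh u := by
    rw [Real.sinh_eq, two_mul, Real.exp_add, Real.exp_neg]
    field_simp
    ring
  rw [hexp, Real.sinh_two_mul, Real.sinh_sub, ← Real.cosh_sub_sinh x]
  field_simp
  rw [← Real.cosh_add_sinh u]
  linear_combination (-Real.cosh x) * Real.cosh_sq u

theorem hasDerivAt_two_mul_arctan_exp (u : ℝ) :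
    HasDerivAt (fun u => 2 * Real.arctan (Real.exp u)) (1 / Real.cosh u) u := by
  refine ((Real.hasDerivAt_exp u).arctan.const_mul 2).congr_deriv ?_
  rw [Real.cosh_eq, Real.exp_neg]
  have := Real.exp_pos u
  field_simp
  ring


/-- For every `x > 0`,
`∫_0^x sinh(x-u) u(1-e^{2u})/sinh(2u) du
  = -1 + x + e^{-x} - 2C cosh(x) + 2 cosh(x)(Ti₂(e^x) - x arctan(e^x))`,
where `C` is Catalan's constant and `Ti₂(u) = ∫_0^u arctan(v)/v dv`. -/
theorem convolution_sinh_bdcf_kernel (x : ℝ) (hx : 0 < x) :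
    ∫ u in (0 : ℝ)..x, Real.sinh (x - u) * (u * (1 - Real.exp (2 * u)) / Real.sinh (2 * u)) =
      -1 + x + Real.exp (-x)
        - 2 * (∑' n : ℕ, (-1) ^ n / (2 * (n : ℝ) + 1) ^ 2) * Real.cosh x
        + 2 * Real.cosh x *
          ((∫ v in (0 : ℝ)..Real.exp x, Real.arctan v / v) - x * Real.arctan (Real.exp x)) := by
  simp only [sinh_sub_mul_bdcf_kernel]
  have hderiv (u : ℝ) : HasDerivAt
      (fun u => Real.exp (-x) * (u * Real.exp u - Real.exp u) -
        Real.cosh x * (u * (2 * Real.arctan (Real.exp u)) -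
          2 * ∫ v in (0 : ℝ)..Real.exp u, Real.arctan v / v))
      (Real.exp (-x) * (u * Real.exp u) - Real.cosh x * (u / Real.cosh u)) u := by
    have hexp := Real.hasDerivAt_exp u
    have hTi := (hasDerivAt_integral_arctan_div_self (Real.exp_pos u)).comp u hexp
    have hid := hasDerivAt_id' u
    refine ((((hid.mul hexp).sub hexp).const_mul (Real.exp (-x))).sub
      (((hid.mul (hasDerivAt_two_mul_arctan_exp u)).sub (hTi.const_mul 2)).const_mul
        (Real.cosh x))).congr_deriv ?_
    have := (Real.exp_pos u).ne'
    field_simp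
    ring
  have hcont : Continuous fun u =>
      Real.exp (-x) * (u * Real.exp u) - Real.cosh x * (u / Real.cosh u) := by
    have h : ∀ u, Real.cosh u ≠ 0 := fun u => (Real.cosh_pos u).ne'
    fun_prop (disch := assumption)
  rw [intervalIntegral.integral_eq_sub_of_hasDerivAt (fun u _ => hderiv u)
    (hcont.intervalIntegrable 0 x), Real.exp_zero, integral_arctan_div_self_zero_one]
  have h : Real.exp (-x) * Real.exp x = 1 := by rw [← Real.exp_add]; simp
  linear_combination (x - 1) * h
end
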